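/- Let T>0, γ∈(1/2,1), δ>1/γ, and let Y:[0,T]×ℝ^d→ℝ^d be continuous in time and continuously differentiable in space, satisfying (i) |Y_{s,t}(x)|+|∇Y_{s,t}(x)| ≤ G(x)|t−s|^γ and (ii) |∇Y_{s,t}(x)−∇Y_{s,t}(y)| ≤ F(x,y)|t−s|^γ|x−y|^{δ−1} for all s,t∈[0,T], x,y∈ℝ^d, where G:ℝ^d→[0,∞) and F:ℝ^{2d}→[0,∞) are locally bounded. Then for every x∈ℝ^d there exist a maximal existence time T*(x)∈(0,T]∪{∞} and a unique path y∈C^γ([0,T*(x))∩[0,T],ℝ^d) with y_t = x + ∫_0^t Y_{dr}(y_r) (nonlinear Young integral) for all t<min(T*(x),T). If T*(x)<∞ then |y_t|→∞ as t↑T*(x); the map x↦T*(x)^{-1} is locally bounded; and if G and F are bounded then T*(x)=∞ for every x. -/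

import Mathlib

noncomputable section
open MeasureTheory Set Filter
open scoped ENNReal NNReal

abbrev Euc (d : ℕ) : Type := EuclideanSpace ℝ (Fin d)

/-- Convergence of Riemann sums of the germ `Ξ` over partitions of `[s,t]` to the limit `I`, as
the mesh of the partition tends to `0`. -/
def RiemannConv {V : Type*} [NormedAddCommGroup V] (Xi : ℝ → ℝ → V) (s t : ℝ) (I : V) : Prop :=
  ∀ ε : ℝ, 0 < ε → ∃ δ : ℝ, 0 < δ ∧ ∀ (k : ℕ) (p : ℕ → ℝ),
    p 0 = s → p k = t → (∀ i < k, p i ≤ p (i + 1)) → (∀ i < k, p (i + 1) - p i ≤ δ) →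
    ‖(∑ i ∈ Finset.range k, Xi (p i) (p (i + 1))) - I‖ < ε

/-- `y` solves the nonlinear Young equation `y_t = x + ∫_0^t Φ(dr, y_r)` on `[0, T⋆) ∩ [0, T]`:
`y_0 = x`, `y` is `γ`-Hölder continuous on compact subintervals for every exponent `γ ∈ Γ`, and
for every `t < min(T⋆, T)` the Riemann sums `∑_{[u,v]} Φ u v (y u)` over partitions of `[0,t]`
converge to `y t − x` as the mesh tends to `0`. -/
def IsNLYoungSolution {V : Type*} [NormedAddCommGroup V] (T : ℝ) (Γ : Set ℝ)
    (Φ : ℝ → ℝ → V → V) (x : V) (Tstar : ℝ≥0∞) (y : ℝ → V) : Prop :=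
  y 0 = x ∧
  (∀ τ : ℝ, 0 ≤ τ → τ ≤ T → ENNReal.ofReal τ < Tstar →
    ∀ γ ∈ Γ, ∃ C : ℝ, ∀ u ∈ Set.Icc (0:ℝ) τ, ∀ v ∈ Set.Icc (0:ℝ) τ,
      ‖y v - y u‖ ≤ C * |v - u| ^ γ) ∧
  ∀ t : ℝ, 0 ≤ t → t < T → ENNReal.ofReal t < Tstar →
    RiemannConv (fun u v => Φ u v (y u)) 0 t (y t - x)

/-- Discrete sewing: an almost-subadditive array along a monotone sequence of times which vanishes
on consecutive indices is controlled by a power of the elapsed time. -/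
lemma discrete_sewing {p : ℕ → ℝ} (hp : Monotone p) {n : ℕ} {R : ℕ → ℕ → ℝ} {θ K L : ℝ}
    (hK : 0 ≤ K) (hKL : 2 * K + 2 ^ (1 - θ) * L ≤ L) (hL : 0 ≤ L) (hθ : 0 ≤ θ)
    (h0 : ∀ i, R i i ≤ 0) (h1 : ∀ i < n, R i (i + 1) ≤ 0)
    (hstep : ∀ i l j, i ≤ l → l ≤ j → j ≤ n → R i l ≤ L * (p l - p i) ^ θ →
      R i j ≤ R i l + R l j + K * (p j - p i) ^ θ) :
    ∀ i j, i ≤ j → j ≤ n → R i j ≤ L * (p j - p i) ^ θ := by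
  have key : ∀ m i j, j - i = m → i ≤ j → j ≤ n → R i j ≤ L * (p j - p i) ^ θ := by
    intro m
    induction m using Nat.strong_induction_on with
    | _ m ih =>
      intro i j hm hij hjn
      have hnn : ∀ a b, a ≤ b → 0 ≤ L * (p b - p a) ^ θ := fun a b hab =>
        mul_nonneg hL (Real.rpow_nonneg (sub_nonneg.2 (hp hab)) _)
      rcases hij.eq_or_lt with rfl | hlt
      · exact (h0 i).trans (hnn i i le_rfl)
      set τ := p j - p i with hτ
      have hτ0 : 0 ≤ τ := sub_nonneg.2 (hp hij)
      have hex : ∃ m, i < m ∧ p i + τ / 2 ≤ p m := ⟨j, hlt, by linarith⟩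
      classical
      obtain ⟨hm1, hm2⟩ := Nat.find_spec hex
      have hmj : Nat.find hex ≤ j := Nat.find_min' hex ⟨hlt, by linarith⟩
      obtain ⟨l, hl⟩ : ∃ l, Nat.find hex = l + 1 := ⟨Nat.find hex - 1, by omega⟩
      have hmin := Nat.find_min hex (m := l) (by omega)
      rw [hl] at hm1 hm2 hmj
      have hil : i ≤ l := by omega
      have hpl : p l - p i ≤ τ / 2 := by
        rcases hil.eq_or_lt with rfl | h
        · simp only [sub_self]; positivity
        · have : ¬ (p i + τ / 2 ≤ p l) := fun h' => hmin ⟨h, h'⟩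
          linarith
      have hpl' : p j - p (l + 1) ≤ τ / 2 := by linarith
      have e1 := ih (l - i) (by omega) i l rfl hil (by omega)
      have e2 := ih (j - (l + 1)) (by omega) (l + 1) j rfl hmj hjn
      have s1 := hstep i l j hil (by omega) hjn e1
      have s2 := hstep l (l + 1) j (by omega) hmj hjn
        ((h1 l (by omega)).trans (hnn l (l + 1) (by omega)))
      have h1l := h1 l (by omega)
      have b1 : (p l - p i) ^ θ ≤ (τ / 2) ^ θ :=
        Real.rpow_le_rpow (sub_nonneg.2 (hp hil)) hpl hθ
      have b2 : (p j - p (l + 1)) ^ θ ≤ (τ / 2) ^ θ :=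
        Real.rpow_le_rpow (sub_nonneg.2 (hp hmj)) hpl' hθ
      have b3 : (p j - p l) ^ θ ≤ τ ^ θ :=
        Real.rpow_le_rpow (sub_nonneg.2 (hp (by omega))) (by linarith [hp hil]) hθ
      have hhalf : 2 * (τ / 2) ^ θ = 2 ^ (1 - θ) * τ ^ θ := by
        rw [Real.div_rpow hτ0 (by norm_num), Real.rpow_sub (by norm_num), Real.rpow_one]
        ring
      have b1' := mul_le_mul_of_nonneg_left b1 hL
      have b2' := mul_le_mul_of_nonneg_left b2 hL
      have b3' := mul_le_mul_of_nonneg_left b3 hK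
      have := mul_le_mul_of_nonneg_right hKL (Real.rpow_nonneg hτ0 θ)
      have h5 : L * (2 * (τ / 2) ^ θ) = L * (2 ^ (1 - θ) * τ ^ θ) := by rw [hhalf]
      nlinarith
  exact fun i j hij hj => key _ i j rfl hij hj

/-- The constant of the sewing lemma. -/
def sewingConst (θ : ℝ) : ℝ := 2 / (1 - 2 ^ (1 - θ))

lemma two_rpow_one_sub_lt_one {θ : ℝ} (hθ : 1 < θ) : (2 : ℝ) ^ (1 - θ) < 1 :=
  Real.rpow_lt_one_of_one_lt_of_neg (by norm_num) (by linarith)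

lemma sewingConst_pos {θ : ℝ} (hθ : 1 < θ) : 0 < sewingConst θ :=
  div_pos two_pos (sub_pos.2 (two_rpow_one_sub_lt_one hθ))

lemma sewingConst_spec {θ : ℝ} (hθ : 1 < θ) (K : ℝ) :
    2 * K + 2 ^ (1 - θ) * (sewingConst θ * K) = sewingConst θ * K := by
  have := sub_pos.2 (two_rpow_one_sub_lt_one hθ)
  unfold sewingConst
  field_simp
  ring

lemma uniform_partition {s t : ℝ} (hst : s ≤ t) {η : ℝ} (hη : 0 < η) :
    ∃ (k : ℕ) (p : ℕ → ℝ), Monotone p ∧ p 0 = s ∧ p k = t ∧ ∀ i, p (i + 1) - p i ≤ η := by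
  obtain ⟨N, hN⟩ := exists_nat_gt ((t - s) / η)
  have hN0 : (0 : ℝ) < N := (div_nonneg (sub_nonneg.2 hst) hη.le).trans_lt hN
  have hd : 0 ≤ (t - s) / N := div_nonneg (sub_nonneg.2 hst) hN0.le
  refine ⟨N, fun i => s + i * ((t - s) / N), ?_, by simp, by field_simp; ring, fun i => ?_⟩
  · intro i j hij
    have : (i : ℝ) ≤ j := by exact_mod_cast hij
    have := mul_le_mul_of_nonneg_right this hd
    simpa using this
  · have : (t - s) / N ≤ η := by
      rw [div_lt_iff₀ hη] at hN
      rw [div_le_iff₀ hN0]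
      linarith
    push_cast
    linarith

section Sewing
variable {V : Type*} [NormedAddCommGroup V]

/-- A germ with small defect of additivity and vanishing Riemann sums is small. -/
lemma norm_le_of_riemannConv_zero {Xi : ℝ → ℝ → V} {s t K θ : ℝ} (hθ : 1 < θ) (hst : s ≤ t)
    (hK : 0 ≤ K) (h0 : ∀ u, Xi u u = 0)
    (hadd : ∀ u v w, s ≤ u → u ≤ v → v ≤ w → w ≤ t →
      ‖Xi u w - Xi u v - Xi v w‖ ≤ K * (w - u) ^ θ)
    (hR : RiemannConv Xi s t 0) : ‖Xi s t‖ ≤ sewingConst θ * K * (t - s) ^ θ := by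
  refine le_of_forall_pos_le_add fun ε hε => ?_
  obtain ⟨η, hη, hconv⟩ := hR ε hε
  obtain ⟨k, p, hp, hp0, hpk, hmesh⟩ := uniform_partition hst hη
  have hsum := hconv k p hp0 hpk (fun i _ => hp (Nat.le_succ i)) (fun i _ => hmesh i)
  rw [sub_zero] at hsum
  have hmain := discrete_sewing hp (n := k) (θ := θ) (K := K) (L := sewingConst θ * K)
    (R := fun i j => ‖Xi (p i) (p j) - ∑ m ∈ Finset.Ico i j, Xi (p m) (p (m + 1))‖)
    hK (sewingConst_spec hθ K).le (mul_nonneg (sewingConst_pos hθ).le hK) (by linarith)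
    (by simp [h0]) (by simp) ?_ 0 k (Nat.zero_le _) le_rfl
  · rw [hp0, hpk, ← Finset.range_eq_Ico] at hmain
    calc ‖Xi s t‖ = ‖(Xi s t - ∑ i ∈ Finset.range k, Xi (p i) (p (i + 1)))
          + ∑ i ∈ Finset.range k, Xi (p i) (p (i + 1))‖ := by simp
      _ ≤ _ := (norm_add_le _ _).trans (add_le_add hmain hsum.le)
  · intro i l j hil hlj hjk _
    have hb := hadd (p i) (p l) (p j) (hp0 ▸ hp (Nat.zero_le _)) (hp hil) (hp hlj)
      (hpk ▸ hp hjk)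
    rw [← Finset.sum_Ico_consecutive _ hil hlj]
    refine le_trans ?_ (add_le_add_right hb _)
    refine le_trans (le_of_eq ?_) (norm_add₃_le (E := V))
    congr 1
    abel

lemma mem_Icc_of_partition {p : ℕ → ℝ} {k : ℕ} (hp : ∀ i < k, p i ≤ p (i + 1)) {i : ℕ}
    (hi : i ≤ k) : p 0 ≤ p i ∧ p i ≤ p k := by
  constructor
  · induction i with
    | zero => exact le_rfl
    | succ i ih => exact (ih (by omega)).trans (hp i (by omega))
  · induction hi using Nat.decreasingInduction with
    | self => exact le_rfl
    | of_succ i h ih => exact (hp i h).trans ih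

lemma riemannConv_zero_of_norm_le {Xi : ℝ → ℝ → V} {s t C β : ℝ} (hβ : 1 < β)
    (hXi : ∀ u v, s ≤ u → u ≤ v → v ≤ t → ‖Xi u v‖ ≤ C * (v - u) ^ β) :
    RiemannConv Xi s t 0 := by
  intro ε hε
  have hA : 0 < |C| * |t - s| + 1 := by positivity
  set A := |C| * |t - s| + 1 with hAdef
  refine ⟨(ε / A) ^ (1 / (β - 1)), Real.rpow_pos_of_pos (div_pos hε hA) _, ?_⟩
  intro k p hp0 hpk hp hmesh
  have hmem := fun i (hi : i ≤ k) => mem_Icc_of_partition hp hi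
  rw [hp0, hpk] at hmem
  have hst : s ≤ t := (hmem 0 (Nat.zero_le _)).1.trans (hmem 0 (Nat.zero_le _)).2
  have hη : ((ε / A) ^ (1 / (β - 1))) ^ (β - 1) = ε / A := by
    rw [← Real.rpow_mul (div_pos hε hA).le, one_div_mul_cancel (by linarith), Real.rpow_one]
  rw [sub_zero]
  have hterm : ∀ i ∈ Finset.range k,
      ‖Xi (p i) (p (i + 1))‖ ≤ |C| * (ε / A) * (p (i + 1) - p i) := by
    intro i hi
    have hik := Finset.mem_range.1 hi
    have hd : 0 ≤ p (i + 1) - p i := sub_nonneg.2 (hp i hik)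
    have h1 := hXi (p i) (p (i + 1)) (hmem i hik.le).1 (hp i hik) (hmem (i + 1) hik).2
    have h2 : (p (i + 1) - p i) ^ β = (p (i + 1) - p i) ^ (β - 1) * (p (i + 1) - p i) := by
      rw [← Real.rpow_add_one' hd (by linarith)]
      ring_nf
    have h3 : (p (i + 1) - p i) ^ (β - 1) ≤ ε / A := by
      rw [← hη]
      exact Real.rpow_le_rpow hd (hmesh i hik) (by linarith)
    calc ‖Xi (p i) (p (i + 1))‖ ≤ C * (p (i + 1) - p i) ^ β := h1
      _ ≤ |C| * (p (i + 1) - p i) ^ β := by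
          gcongr
          exact le_abs_self C
      _ ≤ |C| * (ε / A * (p (i + 1) - p i)) := by
          rw [h2]
          gcongr
      _ = _ := by ring
  calc ‖∑ i ∈ Finset.range k, Xi (p i) (p (i + 1))‖
      ≤ ∑ i ∈ Finset.range k, |C| * (ε / A) * (p (i + 1) - p i) :=
        (norm_sum_le _ _).trans (Finset.sum_le_sum hterm)
    _ = |C| * |t - s| / A * ε := by
        rw [← Finset.mul_sum, Finset.sum_range_sub, hp0, hpk, abs_of_nonneg (sub_nonneg.2 hst)]
        ring
    _ < 1 * ε := by
        gcongr
        rw [div_lt_one hA, hAdef]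
        linarith
    _ = ε := one_mul ε

lemma riemannConv_sub_increment_iff {Xi : ℝ → ℝ → V} {y : ℝ → V} {s t : ℝ} :
    RiemannConv (fun u v => Xi u v - (y v - y u)) s t 0 ↔ RiemannConv Xi s t (y t - y s) := by
  refine forall₂_congr fun ε _ => exists_congr fun η => and_congr_right fun _ =>
    forall₄_congr fun k p hp0 hpk => ?_
  rw [Finset.sum_sub_distrib, Finset.sum_range_sub (fun i => y (p i)), hp0, hpk, sub_zero]

/-- Convergence of Riemann sums on `[a, s]` and `[a, t]` gives convergence on `[s, t]`. -/
lemma RiemannConv.sub_left {Xi : ℝ → ℝ → V} {a s t : ℝ} {I J : V} (has : a ≤ s)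
    (hI : RiemannConv Xi a s I) (hJ : RiemannConv Xi a t J) : RiemannConv Xi s t (J - I) := by
  intro ε hε
  obtain ⟨η₁, hη₁, h₁⟩ := hI (ε / 2) (half_pos hε)
  obtain ⟨η₂, hη₂, h₂⟩ := hJ (ε / 2) (half_pos hε)
  refine ⟨η₂, hη₂, fun k p hp0 hpk hp hmesh => ?_⟩
  obtain ⟨N, q, hq, hq0, hqN, hqmesh⟩ := uniform_partition has (lt_min hη₁ hη₂)
  have e₁ := h₁ N q hq0 hqN (fun i _ => hq (Nat.le_succ i))
    (fun i _ => (hqmesh i).trans (min_le_left _ _))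
  set r : ℕ → ℝ := fun i => if i < N then q i else p (i - N) with hr
  have hrq : ∀ i ≤ N, r i = q i := by
    intro i hi
    rcases hi.eq_or_lt with rfl | h
    · simp [hr, hqN, hp0]
    · simp [hr, h]
  have hrp : ∀ i, r (N + i) = p i := fun i => by simp [hr]
  have e₂ := h₂ (N + k) r (by rw [hrq 0 (Nat.zero_le _), hq0]) (by rw [hrp, hpk]) ?_ ?_
  · rw [Finset.sum_range_add] at e₂
    have s1 : ∑ i ∈ Finset.range N, Xi (r i) (r (i + 1)) =
        ∑ i ∈ Finset.range N, Xi (q i) (q (i + 1)) := by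
      refine Finset.sum_congr rfl fun i hi => ?_
      have := Finset.mem_range.1 hi
      rw [hrq i this.le, hrq (i + 1) this]
    have s2 : ∑ i ∈ Finset.range k, Xi (r (N + i)) (r (N + i + 1)) =
        ∑ i ∈ Finset.range k, Xi (p i) (p (i + 1)) := by
      refine Finset.sum_congr rfl fun i _ => ?_
      rw [hrp, add_assoc, hrp]
    rw [s1, s2] at e₂
    calc _ = ‖((∑ i ∈ Finset.range N, Xi (q i) (q (i + 1)) +
          ∑ i ∈ Finset.range k, Xi (p i) (p (i + 1))) - J) -
          (∑ i ∈ Finset.range N, Xi (q i) (q (i + 1)) - I)‖ := by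
            congr 1
            abel
      _ ≤ _ := norm_sub_le _ _
      _ < ε / 2 + ε / 2 := add_lt_add e₂ e₁
      _ = ε := add_halves ε
  all_goals
    intro i hi
    rcases lt_or_ge i N with h | h
    · rw [hrq i h.le, hrq (i + 1) h]
      first
        | exact hq (Nat.le_succ i)
        | exact (hqmesh i).trans (min_le_right _ _)
    · obtain ⟨j, rfl⟩ := Nat.exists_eq_add_of_le h
      rw [hrp, add_assoc, hrp]
      first
        | exact hp j (by omega)
        | exact hmesh j (by omega)

end Sewing

section Calculus
variable {E : Type*} [NormedAddCommGroup E] [NormedSpace ℝ E]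

/-- Second-order increment estimate for a function with Hölder continuous derivative. -/
lemma norm_sub_sub_sub_le_of_fderiv {f : E → E} (hf : Differentiable ℝ f) {B : Set E}
    (hB : Convex ℝ B) {A Q κ ρ : ℝ} (hκ : 0 ≤ κ) (hQ : 0 ≤ Q)
    (h1 : ∀ z ∈ B, ‖fderiv ℝ f z‖ ≤ A)
    (h2 : ∀ z ∈ B, ∀ z' ∈ B, ‖fderiv ℝ f z - fderiv ℝ f z'‖ ≤ Q * ‖z - z'‖ ^ κ)
    {a b a' b' : E} (ha : a ∈ B) (hb : b ∈ B) (ha' : a' ∈ B) (hb' : b' ∈ B)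
    (haa : ‖a - a'‖ ≤ ρ) (hbb : ‖b - b'‖ ≤ ρ) :
    ‖(f a - f b) - (f a' - f b')‖ ≤ A * ‖(a - b) - (a' - b')‖ + Q * ρ ^ κ * ‖a - b‖ := by
  have hline : ∀ (c e : E) (θ : ℝ), HasDerivAt (fun θ : ℝ => f (c + θ • (e - c)))
      (fderiv ℝ f (c + θ • (e - c)) (e - c)) θ := by
    intro c e θ
    have hd : HasDerivAt (fun θ : ℝ => c + θ • (e - c)) (e - c) θ := by
      simpa using ((hasDerivAt_id θ).smul_const (e - c)).const_add c
    exact (hf _).hasFDerivAt.comp_hasDerivAt θ hd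
  have hmem : ∀ c ∈ B, ∀ e ∈ B, ∀ θ ∈ Ico (0 : ℝ) 1, c + θ • (e - c) ∈ B :=
    fun c hc e he θ hθ => hB.add_smul_sub_mem hc he ⟨hθ.1, hθ.2.le⟩
  have := norm_image_sub_le_of_norm_deriv_le_segment_01'
    (f := fun θ : ℝ => f (b + θ • (a - b)) - f (b' + θ • (a' - b')))
    (C := A * ‖(a - b) - (a' - b')‖ + Q * ρ ^ κ * ‖a - b‖)
    (fun θ _ => ((hline b a θ).sub (hline b' a' θ)).hasDerivWithinAt) ?_
  · refine le_trans (le_of_eq ?_) this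
    simp only [one_smul, add_sub_cancel, zero_smul, add_zero]
    congr 1
    abel
  · intro θ hθ
    set z := b + θ • (a - b) with hz
    set z' := b' + θ • (a' - b') with hz'
    have hzB : z ∈ B := hmem b hb a ha θ hθ
    have hzB' : z' ∈ B := hmem b' hb' a' ha' θ hθ
    have hzz : ‖z - z'‖ ≤ ρ := by
      have e : z - z' = (1 - θ) • (b - b') + θ • (a - a') := by
        rw [hz, hz']
        module
      rw [e]
      refine (norm_add_le _ _).trans ?_
      rw [norm_smul, norm_smul, Real.norm_of_nonneg hθ.1,
        Real.norm_of_nonneg (sub_nonneg.2 hθ.2.le)]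
      nlinarith [mul_le_mul_of_nonneg_left hbb (sub_nonneg.2 hθ.2.le),
        mul_le_mul_of_nonneg_left haa hθ.1]
    have e : fderiv ℝ f z (a - b) - fderiv ℝ f z' (a' - b') =
        fderiv ℝ f z' ((a - b) - (a' - b')) + (fderiv ℝ f z - fderiv ℝ f z') (a - b) := by
      simp only [map_sub, sub_apply]
      abel
    rw [e]
    refine (norm_add_le _ _).trans (add_le_add ?_ ?_)
    · exact (ContinuousLinearMap.le_opNorm _ _).trans
        (mul_le_mul_of_nonneg_right (h1 z' hzB') (norm_nonneg _))
    · refine (ContinuousLinearMap.le_opNorm _ _).trans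
        (mul_le_mul_of_nonneg_right ((h2 z hzB z' hzB').trans ?_) (norm_nonneg _))
      exact mul_le_mul_of_nonneg_left (Real.rpow_le_rpow (norm_nonneg _) hzz hκ) hQ

end Calculus

section Euler
variable {E : Type*} [NormedAddCommGroup E]

/-- The increments of `Y` are bounded and Lipschitz on `B`, with constant `M (t - s) ^ γ`. -/
structure YoungBounds (Y : ℝ → E → E) (T γ : ℝ) (B : Set E) (M : ℝ) : Prop where
  nonneg : 0 ≤ M
  sup : ∀ s t, 0 ≤ s → s ≤ t → t ≤ T → ∀ z ∈ B, ‖Y t z - Y s z‖ ≤ M * (t - s) ^ γ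
  lip : ∀ s t, 0 ≤ s → s ≤ t → t ≤ T → ∀ z ∈ B, ∀ z' ∈ B,
    ‖(Y t z - Y s z) - (Y t z' - Y s z')‖ ≤ M * (t - s) ^ γ * ‖z - z'‖

lemma rpow_two_mul_eq {x : ℝ} (hx : 0 ≤ x) (γ : ℝ) : x ^ (2 * γ) = x ^ γ * x ^ γ := by
  rw [two_mul]
  rcases eq_or_ne (γ + γ) 0 with h | h
  · have : γ = 0 := by linarith
    simp [this]
  · exact Real.rpow_add' hx h

/-- The Euler scheme stays in the unit ball and satisfies a local expansion of order `2γ`. -/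
lemma euler_scheme_bound {Y : ℝ → E → E} {T γ M h : ℝ} {x : E} (hγ : 1 / 2 < γ)
    (hY : YoungBounds Y T γ (Metric.closedBall x 1) M)
    (hh1 : M * h ^ γ ≤ 1 / 2) (hh2 : sewingConst (2 * γ) * (2 * (M * h ^ γ)) ≤ 1)
    {p : ℕ → ℝ} (hp : Monotone p) (hp0 : 0 ≤ p 0) {u : ℕ → E} (hu0 : u 0 = x)
    (hu : ∀ i, u (i + 1) = u i + (Y (p (i + 1)) (u i) - Y (p i) (u i)))
    {n : ℕ} (hnh : p n - p 0 ≤ h) (hnT : p n ≤ T) :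
    (∀ i ≤ n, u i ∈ Metric.closedBall x 1) ∧ ∀ i j, i ≤ j → j ≤ n →
      ‖u j - u i - (Y (p j) (u i) - Y (p i) (u i))‖ ≤
        sewingConst (2 * γ) * (2 * M ^ 2) * (p j - p i) ^ (2 * γ) := by
  have hM := hY.nonneg
  have hθ : 1 < 2 * γ := by linarith
  have hc := sewingConst_pos hθ
  have hpow : ∀ i j, i ≤ j → j ≤ n → 0 ≤ (p j - p i) ^ γ ∧ (p j - p i) ^ γ ≤ h ^ γ := by
    intro i j hij hj
    have h0 : 0 ≤ p j - p i := sub_nonneg.2 (hp hij)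
    exact ⟨Real.rpow_nonneg h0 _, Real.rpow_le_rpow h0
      (by linarith [hp (Nat.zero_le i), hp hj]) (by linarith)⟩
  have hrem : ∀ i j, i ≤ j → j ≤ n →
      sewingConst (2 * γ) * (2 * M ^ 2) * (p j - p i) ^ (2 * γ) ≤ M * (p j - p i) ^ γ := by
    intro i j hij hj
    obtain ⟨h0, h1⟩ := hpow i j hij hj
    rw [rpow_two_mul_eq (sub_nonneg.2 (hp hij))]
    have h2 : sewingConst (2 * γ) * (2 * (M * (p j - p i) ^ γ)) ≤ 1 := by
      refine le_trans ?_ hh2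
      gcongr
    calc _ = sewingConst (2 * γ) * (2 * (M * (p j - p i) ^ γ)) * (M * (p j - p i) ^ γ) := by ring
      _ ≤ 1 * (M * (p j - p i) ^ γ) := by gcongr
      _ = _ := one_mul _
  have hincr : ∀ i j, i ≤ j → j ≤ n → u i ∈ Metric.closedBall x 1 →
      ‖u j - u i - (Y (p j) (u i) - Y (p i) (u i))‖ ≤
        sewingConst (2 * γ) * (2 * M ^ 2) * (p j - p i) ^ (2 * γ) →
      ‖u j - u i‖ ≤ 2 * M * (p j - p i) ^ γ := by
    intro i j hij hj hui hR
    have h1 := hY.sup (p i) (p j) (hp0.trans (hp (Nat.zero_le i))) (hp hij)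
      ((hp hj).trans hnT) _ hui
    have h2 := norm_add_le (u j - u i - (Y (p j) (u i) - Y (p i) (u i)))
      (Y (p j) (u i) - Y (p i) (u i))
    rw [sub_add_cancel] at h2
    linarith [hrem i j hij hj]
  have hexp : ∀ m ≤ n, (∀ i < m, u i ∈ Metric.closedBall x 1) → ∀ i j, i ≤ j → j ≤ m →
      ‖u j - u i - (Y (p j) (u i) - Y (p i) (u i))‖ ≤
        sewingConst (2 * γ) * (2 * M ^ 2) * (p j - p i) ^ (2 * γ) := by
    intro m hmn hball
    refine discrete_sewing hp (K := 2 * M ^ 2)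
      (R := fun i j => ‖u j - u i - (Y (p j) (u i) - Y (p i) (u i))‖)
      (by positivity) (sewingConst_spec hθ _).le (by positivity) (by linarith)
      (by simp) (fun i _ => by simp [hu i]) ?_
    intro i l j hil hlj hjm hRil
    rcases hlj.eq_or_lt with rfl | hlt
    · have : 0 ≤ 2 * M ^ 2 * (p l - p i) ^ (2 * γ) :=
        mul_nonneg (by positivity) (Real.rpow_nonneg (sub_nonneg.2 (hp hil)) _)
      simpa using this
    have hui := hball i (by omega)
    have hul := hball l (by omega)
    have hd := hincr i l hil (by omega) hui hRil
    have hl := hY.lip (p l) (p j) (hp0.trans (hp (Nat.zero_le l))) (hp hlj)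
      ((hp (hjm.trans hmn)).trans hnT) _ hul _ hui
    have hdef : ‖(Y (p j) (u l) - Y (p l) (u l)) - (Y (p j) (u i) - Y (p l) (u i))‖ ≤
        2 * M ^ 2 * (p j - p i) ^ (2 * γ) := by
      rw [rpow_two_mul_eq (sub_nonneg.2 (hp (hil.trans hlj)))]
      have a1 : (p j - p l) ^ γ ≤ (p j - p i) ^ γ :=
        Real.rpow_le_rpow (sub_nonneg.2 (hp hlj)) (by linarith [hp hil]) (by linarith)
      have a2 : (p l - p i) ^ γ ≤ (p j - p i) ^ γ :=
        Real.rpow_le_rpow (sub_nonneg.2 (hp hil)) (by linarith [hp hlj]) (by linarith)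
      have a3 := (hpow l j hlj (by omega)).1
      have a4 := (hpow i j (hil.trans hlj) (by omega)).1
      calc _ ≤ M * (p j - p l) ^ γ * ‖u l - u i‖ := hl
        _ ≤ M * (p j - p i) ^ γ * (2 * M * (p j - p i) ^ γ) := by
            gcongr
            exact hd.trans (by gcongr)
        _ = _ := by ring
    refine le_trans ?_ (add_le_add_right hdef _)
    refine le_trans (le_of_eq ?_) (norm_add₃_le (E := E))
    congr 1
    abel
  have hball : ∀ m ≤ n, ∀ i ≤ m, u i ∈ Metric.closedBall x 1 := by
    intro m
    induction m with
    | zero =>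
      intro _ i hi
      obtain rfl : i = 0 := by omega
      simp [hu0]
    | succ m ih =>
      intro hm i hi
      rcases hi.eq_or_lt with rfl | hlt
      · have hR := hexp (m + 1) hm (fun i hi => ih (by omega) i (by omega)) 0 (m + 1)
          (by omega) le_rfl
        have h0 : u 0 ∈ Metric.closedBall x 1 := by simp [hu0]
        have hd := hincr 0 (m + 1) (by omega) hm h0 hR
        have := mul_le_mul_of_nonneg_left (hpow 0 (m + 1) (by omega) hm).2 hM
        rw [mem_closedBall_iff_norm, ← hu0]
        linarith
      · exact ih (by omega) i (by omega)
  exact ⟨hball n le_rfl, hexp n le_rfl fun i hi => hball n le_rfl i hi.le⟩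

end Euler

section LocalExistence
variable {E : Type*} [NormedAddCommGroup E]

/-- On `[a, b]` the path `y` follows the increments of `Y` up to an error of order `2γ`. -/
def HasLocalExpansion (Y : ℝ → E → E) (γ a b : ℝ) (y : ℝ → E) : Prop :=
  ∃ C : ℝ, ∀ s t, a ≤ s → s ≤ t → t ≤ b →
    ‖y t - y s - (Y t (y s) - Y s (y s))‖ ≤ C * (t - s) ^ (2 * γ)

lemma YoungBounds.tendsto {Y : ℝ → E → E} {T γ M : ℝ} {B : Set E} (hY : YoungBounds Y T γ B M)
    (hγ : 0 < γ) {t : ℝ} (hcont : Continuous (Y t)) (htT : t ≤ T) {ι : Type*} {l : Filter ι}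
    {g : ι → ℝ} {z : ι → E} {z₀ : E} (hg0 : ∀ i, 0 ≤ g i) (hgt : ∀ i, g i ≤ t)
    (hzB : ∀ i, z i ∈ B) (hg : Tendsto g l (nhds t)) (hz : Tendsto z l (nhds z₀)) :
    Tendsto (fun i => Y (g i) (z i)) l (nhds (Y t z₀)) := by
  have h1 : Tendsto (fun i => Y t (z i)) l (nhds (Y t z₀)) := (hcont.tendsto z₀).comp hz
  have h2 : Tendsto (fun i => M * (t - g i) ^ γ) l (nhds 0) := by
    have h3 : Tendsto (fun i => t - g i) l (nhds 0) := by
      simpa using (tendsto_const_nhds (x := t)).sub hg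
    have := (h3.rpow_const (p := γ) (Or.inr hγ.le)).const_mul M
    simpa [Real.zero_rpow hγ.ne'] using this
  have h4 : Tendsto (fun i => Y t (z i) - Y (g i) (z i)) l (nhds 0) :=
    squeeze_zero_norm (fun i => hY.sup (g i) t (hg0 i) (hgt i) htT _ (hzB i)) h2
  simpa using h1.sub h4

lemma exists_hasLocalExpansion [ProperSpace E] {Y : ℝ → E → E} {T γ M h : ℝ} {x : E}
    (hγ : 1 / 2 < γ) (hY : YoungBounds Y T γ (Metric.closedBall x 1) M)
    (hcont : ∀ t, Continuous (Y t))
    (hh1 : M * h ^ γ ≤ 1 / 2) (hh2 : sewingConst (2 * γ) * (2 * (M * h ^ γ)) ≤ 1)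
    {a b : ℝ} (ha : 0 ≤ a) (hab : a ≤ b) (hbh : b - a ≤ h) (hbT : b ≤ T) :
    ∃ y : ℝ → E, y a = x ∧ HasLocalExpansion Y γ a b y := by
  set p : ℕ → ℕ → ℝ := fun N i => a + i / ((N : ℝ) + 1) with hp
  have hpmono : ∀ N, Monotone (p N) := by
    intro N i j hij
    have : (i : ℝ) ≤ j := by exact_mod_cast hij
    simp only [hp]
    gcongr
  set u : ℕ → ℕ → E := fun N i =>
    Nat.rec x (fun i z => z + (Y (p N (i + 1)) z - Y (p N i) z)) i with hu
  set k : ℕ → ℝ → ℕ := fun N t => ⌊(t - a) * ((N : ℝ) + 1)⌋₊ with hk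
  have hkmono : ∀ N, Monotone (k N) := by
    intro N s t hst
    simp only [hk]
    gcongr
  have hp0 : ∀ N, p N 0 = a := by simp [hp]
  have hpk : ∀ N t, a ≤ t → p N (k N t) ≤ t := by
    intro N t hat
    have h1 : ((k N t : ℕ) : ℝ) ≤ (t - a) * ((N : ℝ) + 1) :=
      Nat.floor_le (mul_nonneg (sub_nonneg.2 hat) (by positivity))
    have h2 : ((k N t : ℕ) : ℝ) / ((N : ℝ) + 1) ≤ t - a := by
      rw [div_le_iff₀ (by positivity)]
      exact h1
    simp only [hp]
    linarith
  have hpa : ∀ N i, a ≤ p N i := fun N i => hp0 N ▸ hpmono N (Nat.zero_le i)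
  have hpt : ∀ t, a ≤ t → Tendsto (fun N => p N (k N t)) atTop (nhds t) := by
    intro t hat
    have h1 := (tendsto_nat_floor_mul_div_atTop (sub_nonneg.2 hat)).comp
      (tendsto_atTop_add_const_right atTop (1 : ℝ) tendsto_natCast_atTop_atTop)
    simpa using h1.const_add a
  have heuler := fun N => euler_scheme_bound hγ hY hh1 hh2 (hpmono N) (ha.trans (hpa N 0))
    (u := u N) rfl (fun i => rfl) (n := k N b) (by linarith [hpk N b hab, hp0 N])
    ((hpk N b hab).trans hbT)
  have hball : ∀ t ≤ b, ∀ N, u N (k N t) ∈ Metric.closedBall x 1 :=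
    fun t ht N => (heuler N).1 _ (hkmono N ht)
  have hlim : ∀ t, ∃ z, t ≤ b →
      Tendsto (fun N => u N (k N t)) (hyperfilter ℕ : Filter ℕ) (nhds z) := by
    intro t
    by_cases ht : t ≤ b
    · obtain ⟨z, -, hz⟩ := (isCompact_closedBall x 1).ultrafilter_le_nhds'
        ((hyperfilter ℕ).map fun N => u N (k N t))
        (Ultrafilter.mem_map.2 (Filter.univ_mem' (hball t ht)))
      exact ⟨z, fun _ => hz⟩
    · exact ⟨x, fun h => absurd h ht⟩
  choose y hy using hlim
  have hle : (hyperfilter ℕ : Filter ℕ) ≤ atTop := by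
    rw [← Nat.cofinite_eq_atTop]
    exact hyperfilter_le_cofinite
  refine ⟨y, ?_, sewingConst (2 * γ) * (2 * M ^ 2), fun s t has hst htb => ?_⟩
  · have h1 : ∀ N, u N (k N a) = x := fun N => by simp [hk, hu]
    have h2 := hy a hab
    simp only [h1] at h2
    exact tendsto_nhds_unique h2 tendsto_const_nhds
  · have hat := has.trans hst
    have hsb := hst.trans htb
    have hgs := (hpt s has).mono_left hle
    have hgt := (hpt t hat).mono_left hle
    have hγ0 : 0 < γ := by linarith
    have l1 := hY.tendsto hγ0 (hcont t) (htb.trans hbT) (fun N => ha.trans (hpa N _))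
      (fun N => hpk N t hat) (hball s hsb) hgt (hy s hsb)
    have l2 := hY.tendsto hγ0 (hcont s) (hsb.trans hbT) (fun N => ha.trans (hpa N _))
      (fun N => hpk N s has) (hball s hsb) hgs (hy s hsb)
    have l3 := (((hy t htb).sub (hy s hsb)).sub (l1.sub l2)).norm
    have l4 := ((hgt.sub hgs).rpow_const (p := 2 * γ) (Or.inr (by linarith))).const_mul
      (sewingConst (2 * γ) * (2 * M ^ 2))
    exact le_of_tendsto_of_tendsto' l3 l4
      fun N => (heuler N).2 _ _ (hkmono N hst) (hkmono N htb)

end LocalExistence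

section Expansion
variable {E : Type*} [NormedAddCommGroup E] {Y : ℝ → E → E} {T γ M : ℝ}

lemma HasLocalExpansion.mono {a b b' : ℝ} {y : ℝ → E} (hy : HasLocalExpansion Y γ a b y)
    (hb : b' ≤ b) : HasLocalExpansion Y γ a b' y := by
  obtain ⟨C, hC⟩ := hy
  exact ⟨C, fun s t hs hst ht => hC s t hs hst (ht.trans hb)⟩

lemma HasLocalExpansion.exists_nonneg {a b : ℝ} {y : ℝ → E} (hy : HasLocalExpansion Y γ a b y) :
    ∃ C : ℝ, 0 ≤ C ∧ ∀ s t, a ≤ s → s ≤ t → t ≤ b →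
      ‖y t - y s - (Y t (y s) - Y s (y s))‖ ≤ C * (t - s) ^ (2 * γ) := by
  obtain ⟨C, hC⟩ := hy
  refine ⟨|C|, abs_nonneg C, fun s t hs hst ht => (hC s t hs hst ht).trans ?_⟩
  have := Real.rpow_nonneg (sub_nonneg.2 hst) (2 * γ)
  gcongr
  exact le_abs_self C

lemma HasLocalExpansion.riemannConv (hγ : 1 / 2 < γ) {a b t : ℝ} {y : ℝ → E}
    (hy : HasLocalExpansion Y γ a b y) (ht : t ≤ b) :
    RiemannConv (fun u v => Y v (y u) - Y u (y u)) a t (y t - y a) := by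
  obtain ⟨C, hC⟩ := hy
  refine riemannConv_sub_increment_iff.1
    (riemannConv_zero_of_norm_le (C := C) (β := 2 * γ) (by linarith) fun u v hu huv hv => ?_)
  rw [norm_sub_rev]
  exact hC u v hu huv (hv.trans ht)

/-- A path with a local expansion is bounded as soon as `Y` is bounded at its initial point. -/
lemma HasLocalExpansion.exists_norm_le (hγ : 0 < γ) {τ : ℝ} (hτ : τ ≤ T) {y : ℝ → E}
    (hy : HasLocalExpansion Y γ 0 τ y) (hM : YoungBounds Y T γ {y 0} M) :
    ∃ R : ℝ, ∀ t, 0 ≤ t → t ≤ τ → ‖y t‖ ≤ R := by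
  obtain ⟨C, hC0, hC⟩ := hy.exists_nonneg
  refine ⟨C * τ ^ (2 * γ) + M * τ ^ γ + ‖y 0‖, fun t h0 ht => ?_⟩
  have h1 := hC 0 t le_rfl h0 ht
  have h2 := hM.sup 0 t le_rfl h0 (ht.trans hτ) (y 0) rfl
  have h3 : C * (t - 0) ^ (2 * γ) ≤ C * τ ^ (2 * γ) := by
    rw [sub_zero]
    gcongr
  have h4 : M * (t - 0) ^ γ ≤ M * τ ^ γ := by
    have := hM.nonneg
    rw [sub_zero]
    gcongr
  calc ‖y t‖ = ‖(y t - y 0 - (Y t (y 0) - Y 0 (y 0))) + (Y t (y 0) - Y 0 (y 0)) + y 0‖ := by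
        congr 1
        abel
    _ ≤ _ := norm_add₃_le.trans (by linarith)

lemma HasLocalExpansion.exists_holder (hγ : 0 < γ) {τ : ℝ} (hτ : τ ≤ T) {y : ℝ → E} {B : Set E}
    (hy : HasLocalExpansion Y γ 0 τ y) (hB : ∀ t, 0 ≤ t → t ≤ τ → y t ∈ B)
    (hM : YoungBounds Y T γ B M) :
    ∃ H : ℝ, 0 ≤ H ∧ ∀ s t, 0 ≤ s → s ≤ t → t ≤ τ → ‖y t - y s‖ ≤ H * (t - s) ^ γ := by
  obtain ⟨C, hC0, hC⟩ := hy.exists_nonneg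
  have hM0 := hM.nonneg
  refine ⟨C * |τ| ^ γ + M, by positivity, fun s t h0 hst ht => ?_⟩
  have h1 := hC s t h0 hst ht
  have h2 := hM.sup s t h0 hst (ht.trans hτ) (y s) (hB s h0 (hst.trans ht))
  rw [rpow_two_mul_eq (sub_nonneg.2 hst)] at h1
  have hts : 0 ≤ t - s := sub_nonneg.2 hst
  have h3 : (t - s) ^ γ ≤ |τ| ^ γ := by
    have : t - s ≤ |τ| := (by linarith : t - s ≤ τ).trans (le_abs_self τ)
    gcongr
  calc ‖y t - y s‖ = ‖(y t - y s - (Y t (y s) - Y s (y s))) + (Y t (y s) - Y s (y s))‖ := by simp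
    _ ≤ C * ((t - s) ^ γ * (t - s) ^ γ) + M * (t - s) ^ γ :=
        (norm_add_le _ _).trans (add_le_add h1 h2)
    _ ≤ C * (|τ| ^ γ * (t - s) ^ γ) + M * (t - s) ^ γ := by gcongr
    _ = _ := by ring

/-- A Hölder path driven by convergent Riemann sums has a local expansion. -/
lemma hasLocalExpansion_of_riemannConv (hγ : 1 / 2 < γ) {τ : ℝ} (hτ : τ ≤ T) {z : ℝ → E}
    {B : Set E} (hM : YoungBounds Y T γ B M) (hB : ∀ t, 0 ≤ t → t ≤ τ → z t ∈ B)
    {H : ℝ} (hH0 : 0 ≤ H)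
    (hH : ∀ s t, 0 ≤ s → s ≤ t → t ≤ τ → ‖z t - z s‖ ≤ H * (t - s) ^ γ)
    (hconv : ∀ t, 0 ≤ t → t ≤ τ →
      RiemannConv (fun u v => Y v (z u) - Y u (z u)) 0 t (z t - z 0)) :
    HasLocalExpansion Y γ 0 τ z := by
  have hM0 := hM.nonneg
  refine ⟨sewingConst (2 * γ) * (M * H), fun s t hs hst ht => ?_⟩
  have hR := (hconv s hs (hst.trans ht)).sub_left hs (hconv t (hs.trans hst) ht)
  rw [sub_sub_sub_cancel_right] at hR
  rw [norm_sub_rev]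
  refine norm_le_of_riemannConv_zero
    (Xi := fun u v => Y v (z u) - Y u (z u) - (z v - z u)) (by linarith) hst
    (by positivity) (by simp) ?_ (riemannConv_sub_increment_iff.2 hR)
  intro u v w hu huv hvw hw
  have hu0 := hs.trans hu
  have h1 := hM.lip v w (hu0.trans huv) hvw ((hw.trans ht).trans hτ) (z u)
    (hB u hu0 (huv.trans (hvw.trans (hw.trans ht)))) (z v)
    (hB v (hu0.trans huv) (hvw.trans (hw.trans ht)))
  have h2 := hH u v hu0 huv (hvw.trans (hw.trans ht))
  rw [norm_sub_rev] at h2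
  have h3 : (w - v) ^ γ ≤ (w - u) ^ γ :=
    Real.rpow_le_rpow (sub_nonneg.2 hvw) (by linarith) (by linarith)
  have h4 : (v - u) ^ γ ≤ (w - u) ^ γ :=
    Real.rpow_le_rpow (sub_nonneg.2 huv) (by linarith) (by linarith)
  have h5 : 0 ≤ (w - v) ^ γ := Real.rpow_nonneg (sub_nonneg.2 hvw) _
  have h6 : 0 ≤ (w - u) ^ γ := h5.trans h3
  rw [rpow_two_mul_eq (by linarith)]
  calc _ = ‖(Y w (z u) - Y v (z u)) - (Y w (z v) - Y v (z v))‖ := by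
        congr 1
        abel
    _ ≤ _ := h1
    _ ≤ M * (w - u) ^ γ * (H * (w - u) ^ γ) := by
        gcongr
        exact h2.trans (by gcongr)
    _ = _ := by ring

/-- Local expansions on adjacent intervals can be glued. -/
lemma HasLocalExpansion.glue (hγ : 0 < γ) {a b : ℝ} (ha : 0 ≤ a) (hab : a ≤ b) (hbT : b ≤ T)
    {y z : ℝ → E} {B : Set E} (hM : YoungBounds Y T γ B M)
    (hB : ∀ t, 0 ≤ t → t ≤ a → y t ∈ B)
    (hy : HasLocalExpansion Y γ 0 a y) (hz : HasLocalExpansion Y γ a b z) (hyz : z a = y a) :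
    HasLocalExpansion Y γ 0 b (fun t => if t ≤ a then y t else z t) := by
  obtain ⟨H, hH0, hH⟩ := hy.exists_holder hγ (hab.trans hbT) hB hM
  obtain ⟨C, hC0, hC⟩ := hy.exists_nonneg
  obtain ⟨D, hD0, hD⟩ := hz.exists_nonneg
  have hM0 := hM.nonneg
  refine ⟨C + D + M * H, fun s t hs hst ht => ?_⟩
  have hts : 0 ≤ (t - s) ^ (2 * γ) := Real.rpow_nonneg (sub_nonneg.2 hst) _
  rcases le_or_gt t a with hta | hta
  · simp only [hta, hst.trans hta, if_true]
    refine (hC s t hs hst hta).trans ?_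
    gcongr
    nlinarith
  rcases le_or_gt s a with hsa | hsa
  · simp only [hsa, hta.not_ge, if_true, if_false]
    have h1 := hC s a hs hsa le_rfl
    have h2 := hD a t le_rfl hta.le ht
    have h3 := hM.lip a t ha hta.le (ht.trans hbT) (y a) (hB a ha le_rfl) (y s) (hB s hs hsa)
    have h4 := hH s a hs hsa le_rfl
    rw [hyz] at h2
    have p1 : (a - s) ^ (2 * γ) ≤ (t - s) ^ (2 * γ) :=
      Real.rpow_le_rpow (sub_nonneg.2 hsa) (by linarith) (by linarith)
    have p2 : (t - a) ^ (2 * γ) ≤ (t - s) ^ (2 * γ) :=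
      Real.rpow_le_rpow (sub_nonneg.2 hta.le) (by linarith) (by linarith)
    have p3 : (a - s) ^ γ ≤ (t - s) ^ γ :=
      Real.rpow_le_rpow (sub_nonneg.2 hsa) (by linarith) (by linarith)
    have p4 : (t - a) ^ γ ≤ (t - s) ^ γ :=
      Real.rpow_le_rpow (sub_nonneg.2 hta.le) (by linarith) (by linarith)
    have p5 : 0 ≤ (t - a) ^ γ := Real.rpow_nonneg (sub_nonneg.2 hta.le) _
    have p6 : 0 ≤ (t - s) ^ γ := p5.trans p4
    have h5 : ‖(Y t (y a) - Y a (y a)) - (Y t (y s) - Y a (y s))‖ ≤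
        M * H * (t - s) ^ (2 * γ) := by
      rw [rpow_two_mul_eq (sub_nonneg.2 hst)]
      calc _ ≤ _ := h3
        _ ≤ M * (t - s) ^ γ * (H * (t - s) ^ γ) := by
            gcongr
            exact h4.trans (by gcongr)
        _ = _ := by ring
    calc _ = ‖(y a - y s - (Y a (y s) - Y s (y s))) + (z t - y a - (Y t (y a) - Y a (y a))) +
          ((Y t (y a) - Y a (y a)) - (Y t (y s) - Y a (y s)))‖ := by
          congr 1
          abel
      _ ≤ C * (t - s) ^ (2 * γ) + D * (t - s) ^ (2 * γ) + M * H * (t - s) ^ (2 * γ) := by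
          refine norm_add₃_le.trans (add_le_add (add_le_add (h1.trans ?_) (h2.trans ?_)) h5)
          · gcongr
          · gcongr
      _ = _ := by ring
  · simp only [hsa.not_ge, hta.not_ge, if_false]
    refine (hD s t hsa.le hst ht).trans ?_
    gcongr
    nlinarith

end Expansion

lemma eventually_mul_rpow_le (A : ℝ) {α c : ℝ} (hα : 0 < α) (hc : 0 < c) :
    ∀ᶠ h in nhdsWithin (0 : ℝ) (Ioi 0), A * h ^ α ≤ c := by
  have h1 : Tendsto (fun h : ℝ => A * h ^ α) (nhds 0) (nhds 0) := by
    have := ((continuous_id.tendsto (0 : ℝ)).rpow_const (p := α) (Or.inr hα.le)).const_mul A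
    simpa [Real.zero_rpow hα.ne'] using this
  exact ((h1.mono_left nhdsWithin_le_nhds).eventually_lt_const hc).mono fun _ h => h.le

section Uniqueness
variable {E : Type*} [NormedAddCommGroup E] {Y : ℝ → E → E} {T γ κ M H : ℝ} {B : Set E}

/-- Second-order increments of `Y` on `B` are controlled with Hölder exponent `κ`. -/
def FourPointBound (Y : ℝ → E → E) (T γ κ : ℝ) (B : Set E) (M : ℝ) : Prop :=
  ∀ s t, 0 ≤ s → s ≤ t → t ≤ T → ∀ a ∈ B, ∀ b ∈ B, ∀ a' ∈ B, ∀ b' ∈ B, ∀ ρ : ℝ,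
    ‖a - a'‖ ≤ ρ → ‖b - b'‖ ≤ ρ →
    ‖((Y t a - Y s a) - (Y t b - Y s b)) - ((Y t a' - Y s a') - (Y t b' - Y s b'))‖ ≤
      M * (t - s) ^ γ * (‖(a - b) - (a' - b')‖ + ρ ^ κ * ‖a - b‖)

/-- On a short interval, a Hölder bound on the difference of two solutions that agree at the
initial point can be halved. -/
lemma holder_bound_half (hγ : 1 / 2 < γ) (hκ : 0 ≤ κ) (hγκ : 1 < γ * (1 + κ))
    (hM : YoungBounds Y T γ B M) (h4 : FourPointBound Y T γ κ B M) {a b h : ℝ} (ha : 0 ≤ a)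
    (hbT : b ≤ T) (hbh : b - a ≤ h) (hh1 : h ≤ 1) (hH0 : 0 ≤ H)
    (hhA : sewingConst (min (2 * γ) (γ * (1 + κ))) * (M * (1 + H ^ κ)) *
      h ^ (min (2 * γ) (γ * (1 + κ)) - γ) ≤ 1 / 4) (hhM : M * h ^ γ ≤ 1 / 4)
    {y z : ℝ → E}
    (hyB : ∀ t, a ≤ t → t ≤ b → y t ∈ B) (hzB : ∀ t, a ≤ t → t ≤ b → z t ∈ B)
    (hyH : ∀ s t, a ≤ s → s ≤ t → t ≤ b → ‖y t - y s‖ ≤ H * (t - s) ^ γ)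
    (hzH : ∀ s t, a ≤ s → s ≤ t → t ≤ b → ‖z t - z s‖ ≤ H * (t - s) ^ γ)
    (hy : HasLocalExpansion Y γ a b y) (hz : HasLocalExpansion Y γ a b z) (hyz : y a = z a)
    {W : ℝ} (hW0 : 0 ≤ W)
    (hW : ∀ s t, a ≤ s → s ≤ t → t ≤ b → ‖(y t - z t) - (y s - z s)‖ ≤ W * (t - s) ^ γ) :
    ∀ s t, a ≤ s → s ≤ t → t ≤ b → ‖(y t - z t) - (y s - z s)‖ ≤ W / 2 * (t - s) ^ γ := by
  intro s t has hst htb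
  have hM0 := hM.nonneg
  obtain ⟨C, hC⟩ := hy
  obtain ⟨D, hD⟩ := hz
  set θ := min (2 * γ) (γ * (1 + κ)) with hθdef
  have hθ : 1 < θ := lt_min (by linarith) hγκ
  have hθγ : γ ≤ θ := le_min (by linarith) (by nlinarith)
  have hwa : ∀ u, a ≤ u → u ≤ b → ‖y u - z u‖ ≤ W * (u - a) ^ γ := by
    intro u hau hub
    have := hW a u le_rfl hau hub
    rwa [hyz, sub_self, sub_zero] at this
  have hw1 : ∀ u, a ≤ u → u ≤ b → ‖y u - z u‖ ≤ W := by
    intro u hau hub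
    refine (hwa u hau hub).trans (mul_le_of_le_one_right hW0 ?_)
    exact Real.rpow_le_one (sub_nonneg.2 hau) (by linarith) (by linarith)
  have hexp : ∀ x β : ℝ, 0 ≤ x → x ≤ 1 → θ ≤ β → x ^ β ≤ x ^ θ := fun x β h0 h1 hβ =>
    Real.rpow_le_rpow_of_exponent_ge_of_imp h0 h1 hβ (fun _ h => by linarith)
  have hE := norm_le_of_riemannConv_zero (θ := θ) (K := M * (1 + H ^ κ) * W)
    (Xi := fun u v => ((y v - z v) - (y u - z u)) -
      ((Y v (y u) - Y u (y u)) - (Y v (z u) - Y u (z u)))) hθ hst (by positivity) (by simp) ?_ ?_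
  · have hts : 0 ≤ t - s := sub_nonneg.2 hst
    have hpow : (t - s) ^ θ ≤ h ^ (θ - γ) * (t - s) ^ γ := by
      calc (t - s) ^ θ = (t - s) ^ (θ - γ) * (t - s) ^ γ := by
            rw [← Real.rpow_add' hts (by linarith)]
            ring_nf
        _ ≤ _ := mul_le_mul_of_nonneg_right
            (Real.rpow_le_rpow hts (by linarith) (by linarith)) (Real.rpow_nonneg hts _)
    have hc := (sewingConst_pos hθ).le
    have e1 : sewingConst θ * (M * (1 + H ^ κ) * W) * (t - s) ^ θ ≤ W / 4 * (t - s) ^ γ := by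
      calc _ ≤ sewingConst θ * (M * (1 + H ^ κ) * W) * (h ^ (θ - γ) * (t - s) ^ γ) := by gcongr
        _ = (sewingConst θ * (M * (1 + H ^ κ)) * h ^ (θ - γ)) * (W * (t - s) ^ γ) := by ring
        _ ≤ 1 / 4 * (W * (t - s) ^ γ) := by gcongr
        _ = _ := by ring
    have e2 := hM.lip s t (ha.trans has) hst (htb.trans hbT) (y s) (hyB s has (hst.trans htb))
      (z s) (hzB s has (hst.trans htb))
    have e3 : ‖y s - z s‖ ≤ W * h ^ γ :=
      (hwa s has (hst.trans htb)).trans (mul_le_mul_of_nonneg_left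
        (Real.rpow_le_rpow (sub_nonneg.2 has) (by linarith) (by linarith)) hW0)
    have e4 : M * (t - s) ^ γ * ‖y s - z s‖ ≤ W / 4 * (t - s) ^ γ := by
      calc _ ≤ M * (t - s) ^ γ * (W * h ^ γ) := by gcongr
        _ = (M * h ^ γ) * (W * (t - s) ^ γ) := by ring
        _ ≤ 1 / 4 * (W * (t - s) ^ γ) := by gcongr
        _ = _ := by ring
    have e5 := norm_add_le (((y t - z t) - (y s - z s)) -
      ((Y t (y s) - Y s (y s)) - (Y t (z s) - Y s (z s))))
      ((Y t (y s) - Y s (y s)) - (Y t (z s) - Y s (z s)))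
    rw [sub_add_cancel] at e5
    linarith
  · intro u v r hu huv hvr hr
    have hau := has.trans hu
    have hrb := hr.trans htb
    have hvb := hvr.trans hrb
    have hub := huv.trans hvb
    have hav := hau.trans huv
    have hvu : 0 ≤ v - u := sub_nonneg.2 huv
    have hru : 0 ≤ r - u := by linarith
    have hρ1 := hyH u v hau huv hvb
    have hρ2 := hzH u v hau huv hvb
    rw [norm_sub_rev] at hρ1 hρ2
    have hfp := h4 v r (ha.trans hav) hvr (hrb.trans hbT) (y u) (hyB u hau hub) (z u)
      (hzB u hau hub) (y v) (hyB v hav hvb) (z v) (hzB v hav hvb) _ hρ1 hρ2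
    have hWuv := hW u v hau huv hvb
    rw [norm_sub_rev] at hWuv
    have p1 : (r - v) ^ γ ≤ (r - u) ^ γ :=
      Real.rpow_le_rpow (sub_nonneg.2 hvr) (by linarith) (by linarith)
    have p2 : (v - u) ^ γ ≤ (r - u) ^ γ := Real.rpow_le_rpow hvu (by linarith) (by linarith)
    have p3 : (H * (v - u) ^ γ) ^ κ ≤ H ^ κ * (r - u) ^ (γ * κ) := by
      rw [Real.rpow_mul hru, ← Real.mul_rpow hH0 (Real.rpow_nonneg hru _)]
      exact Real.rpow_le_rpow (mul_nonneg hH0 (Real.rpow_nonneg hvu _)) (by gcongr) hκ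
    have p4 : 0 ≤ (r - u) ^ γ := Real.rpow_nonneg hru _
    have p5 : (r - u) ^ γ * (r - u) ^ γ ≤ (r - u) ^ θ := by
      rw [← rpow_two_mul_eq hru]
      exact hexp _ _ hru (by linarith) (min_le_left _ _)
    have p6 : (r - u) ^ γ * (r - u) ^ (γ * κ) ≤ (r - u) ^ θ := by
      rw [← Real.rpow_add' hru (by nlinarith)]
      refine hexp _ _ hru (by linarith) ((min_le_right _ _).trans (le_of_eq (by ring)))
    have p7 : 0 ≤ (r - u) ^ (γ * κ) := Real.rpow_nonneg hru _
    have p8 : 0 ≤ (r - v) ^ γ := Real.rpow_nonneg (sub_nonneg.2 hvr) _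
    calc _ = ‖((Y r (y v) - Y v (y v)) - (Y r (z v) - Y v (z v))) -
          ((Y r (y u) - Y v (y u)) - (Y r (z u) - Y v (z u)))‖ := by
          congr 1
          abel
      _ = _ := norm_sub_rev _ _
      _ ≤ _ := hfp
      _ ≤ M * (r - u) ^ γ * (W * (r - u) ^ γ + H ^ κ * (r - u) ^ (γ * κ) * W) := by
          gcongr
          · exact hWuv.trans (by gcongr)
          · exact hw1 u hau hub
      _ = M * W * ((r - u) ^ γ * (r - u) ^ γ + H ^ κ * ((r - u) ^ γ * (r - u) ^ (γ * κ))) := by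
          ring
      _ ≤ M * W * ((r - u) ^ θ + H ^ κ * (r - u) ^ θ) := by gcongr
      _ = _ := by ring
  · refine riemannConv_zero_of_norm_le (C := C + D) (β := 2 * γ) (by linarith)
      fun u v hu huv hv => ?_
    have h1 := hC u v (has.trans hu) huv (hv.trans htb)
    have h2 := hD u v (has.trans hu) huv (hv.trans htb)
    calc _ = ‖(y v - y u - (Y v (y u) - Y u (y u))) - (z v - z u - (Y v (z u) - Y u (z u)))‖ := by
          congr 1
          abel
      _ ≤ C * (v - u) ^ (2 * γ) + D * (v - u) ^ (2 * γ) :=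
          (norm_sub_le _ _).trans (add_le_add h1 h2)
      _ = _ := by ring

lemma HasLocalExpansion.unique (hγ : 1 / 2 < γ) (hκ : 0 < κ) (hγκ : 1 < γ * (1 + κ))
    (hM : YoungBounds Y T γ B M) (h4 : FourPointBound Y T γ κ B M) {τ : ℝ} (hτ : τ ≤ T)
    {y z : ℝ → E}
    (hyB : ∀ t, 0 ≤ t → t ≤ τ → y t ∈ B) (hzB : ∀ t, 0 ≤ t → t ≤ τ → z t ∈ B)
    (hy : HasLocalExpansion Y γ 0 τ y) (hz : HasLocalExpansion Y γ 0 τ z) (hyz : y 0 = z 0) :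
    ∀ t, 0 ≤ t → t ≤ τ → y t = z t := by
  obtain ⟨H₁, hH₁, hyH⟩ := hy.exists_holder (by linarith) hτ hyB hM
  obtain ⟨H₂, hH₂, hzH⟩ := hz.exists_holder (by linarith) hτ hzB hM
  set H := H₁ + H₂ with hH
  have hH0 : 0 ≤ H := by positivity
  have hθγ : 0 < min (2 * γ) (γ * (1 + κ)) - γ :=
    sub_pos.2 (lt_min (by linarith) (by nlinarith))
  obtain ⟨h, ⟨⟨hhA, hhM⟩, hh1⟩, hh0⟩ := (((eventually_mul_rpow_le
    (sewingConst (min (2 * γ) (γ * (1 + κ))) * (M * (1 + H ^ κ))) hθγ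
      (by norm_num : (0 : ℝ) < 1 / 4)).and
    (eventually_mul_rpow_le M (by linarith : 0 < γ) (by norm_num : (0 : ℝ) < 1 / 4))).and
    (eventually_mul_rpow_le 1 one_pos one_pos)).and self_mem_nhdsWithin |>.exists
  rw [one_mul, Real.rpow_one] at hh1
  have hh0 : 0 < h := hh0
  have hstep : ∀ a, 0 ≤ a → y a = z a → ∀ t, a ≤ t → t ≤ a + h → t ≤ τ → y t = z t := by
    intro a ha hya t hat hth htτ
    have key : ∀ n : ℕ, ∀ s r, a ≤ s → s ≤ r → r ≤ t →
        ‖(y r - z r) - (y s - z s)‖ ≤ H / 2 ^ n * (r - s) ^ γ := by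
      intro n
      induction n with
      | zero =>
        intro s r has hsr hrt
        have e1 := hyH s r (ha.trans has) hsr (hrt.trans htτ)
        have e2 := hzH s r (ha.trans has) hsr (hrt.trans htτ)
        calc _ = ‖(y r - y s) - (z r - z s)‖ := by
              congr 1
              abel
          _ ≤ H₁ * (r - s) ^ γ + H₂ * (r - s) ^ γ :=
              (norm_sub_le _ _).trans (add_le_add e1 e2)
          _ = _ := by
              rw [hH]
              ring
      | succ n ih =>
        have hmono : ∀ {w : ℝ → E}, HasLocalExpansion Y γ 0 τ w →
            HasLocalExpansion Y γ a t w := fun ⟨C, hC⟩ =>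
          ⟨C, fun s r hs hsr hr => hC s r (ha.trans hs) hsr (hr.trans htτ)⟩
        have hHpow : ∀ s r : ℝ, s ≤ r → 0 ≤ (r - s) ^ γ := fun s r hsr =>
          Real.rpow_nonneg (sub_nonneg.2 hsr) _
        have := holder_bound_half hγ hκ.le hγκ hM h4 ha (htτ.trans hτ) (b := t) (h := h)
          (by linarith) hh1 hH0 hhA hhM (y := y) (z := z)
          (fun r h1 h2 => hyB r (ha.trans h1) (h2.trans htτ))
          (fun r h1 h2 => hzB r (ha.trans h1) (h2.trans htτ))
          (fun s r h1 h2 h3 => (hyH s r (ha.trans h1) h2 (h3.trans htτ)).trans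
            (mul_le_mul_of_nonneg_right (by linarith) (hHpow s r h2)))
          (fun s r h1 h2 h3 => (hzH s r (ha.trans h1) h2 (h3.trans htτ)).trans
            (mul_le_mul_of_nonneg_right (by linarith) (hHpow s r h2)))
          (hmono hy) (hmono hz) hya (by positivity) ih
        rwa [div_div, ← pow_succ] at this
    have hlim : Tendsto (fun n : ℕ => H / 2 ^ n * (t - a) ^ γ) atTop (nhds 0) := by
      have := ((tendsto_pow_atTop_nhds_zero_of_lt_one (r := (1 / 2 : ℝ)) (by norm_num)
        (by norm_num)).const_mul H).mul_const ((t - a) ^ γ)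
      simpa [div_eq_mul_inv] using this
    have hle := ge_of_tendsto' hlim fun n => key n a t le_rfl hat le_rfl
    rw [hya, sub_self, sub_zero] at hle
    exact sub_eq_zero.1 (norm_le_zero_iff.1 hle)
  have hiter : ∀ n : ℕ, ∀ t, 0 ≤ t → t ≤ n * h → t ≤ τ → y t = z t := by
    intro n
    induction n with
    | zero =>
      intro t h0 ht _
      obtain rfl : t = 0 := le_antisymm (by simpa using ht) h0
      exact hyz
    | succ n ih =>
      intro t h0 ht htτ
      push_cast at ht
      rcases le_or_gt t (n * h) with hle | hgt
      · exact ih t h0 hle htτ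
      · have hn : 0 ≤ (n : ℝ) * h := by positivity
        exact hstep (n * h) hn (ih _ hn le_rfl (hgt.le.trans htτ)) t hgt.le (by linarith) htτ
  intro t h0 ht
  obtain ⟨n, hn⟩ := exists_nat_ge (t / h)
  exact hiter n t h0 ((div_le_iff₀ hh0).1 hn) ht

end Uniqueness

section Maximal
variable {E : Type*} [NormedAddCommGroup E] {Y : ℝ → E → E} {T γ κ : ℝ}

lemma YoungBounds.mono {B B' : Set E} {M : ℝ} (hM : YoungBounds Y T γ B M) (hB : B' ⊆ B) :
    YoungBounds Y T γ B' M :=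
  ⟨hM.nonneg, fun s t h0 hst ht z hz => hM.sup s t h0 hst ht z (hB hz),
    fun s t h0 hst ht z hz z' hz' => hM.lip s t h0 hst ht z (hB hz) z' (hB hz')⟩

/-- The estimates on `Y` hold on every ball, with constants depending on the ball. -/
def LocalYoungBounds (Y : ℝ → E → E) (T γ κ : ℝ) : Prop :=
  ∀ R : ℝ, ∃ M : ℝ, YoungBounds Y T γ (Metric.closedBall 0 R) M ∧
    FourPointBound Y T γ κ (Metric.closedBall 0 R) M

/-- There is a solution on `[0, τ]` started at `x`. -/
def Reaches (Y : ℝ → E → E) (γ : ℝ) (x : E) (τ : ℝ) : Prop :=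
  ∃ y : ℝ → E, y 0 = x ∧ HasLocalExpansion Y γ 0 τ y

lemma LocalYoungBounds.exists_mem_closedBall (hY : LocalYoungBounds Y T γ κ) (hγ : 0 < γ)
    {τ : ℝ} (hτ : τ ≤ T) {y : ℝ → E} (hy : HasLocalExpansion Y γ 0 τ y) :
    ∃ R : ℝ, ∀ t, 0 ≤ t → t ≤ τ → y t ∈ Metric.closedBall 0 R := by
  obtain ⟨M, hM, -⟩ := hY ‖y 0‖
  obtain ⟨R, hR⟩ := hy.exists_norm_le hγ hτ (hM.mono (by simp))
  exact ⟨R, fun t h0 ht => by simpa using hR t h0 ht⟩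

lemma LocalYoungBounds.unique (hY : LocalYoungBounds Y T γ κ) (hγ : 1 / 2 < γ) (hκ : 0 < κ)
    (hγκ : 1 < γ * (1 + κ)) {τ : ℝ} (hτ : τ ≤ T) {y z : ℝ → E}
    (hy : HasLocalExpansion Y γ 0 τ y) (hz : HasLocalExpansion Y γ 0 τ z) (hyz : y 0 = z 0) :
    ∀ t, 0 ≤ t → t ≤ τ → y t = z t := by
  obtain ⟨R₁, hR₁⟩ := hY.exists_mem_closedBall (by linarith) hτ hy
  obtain ⟨R₂, hR₂⟩ := hY.exists_mem_closedBall (by linarith) hτ hz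
  obtain ⟨M, hM, h4⟩ := hY (max R₁ R₂)
  exact hy.unique hγ hκ hγκ hM h4 hτ
    (fun t h0 ht => Metric.closedBall_subset_closedBall (le_max_left _ _) (hR₁ t h0 ht))
    (fun t h0 ht => Metric.closedBall_subset_closedBall (le_max_right _ _) (hR₂ t h0 ht)) hz hyz

lemma exists_step (hγ : 1 / 2 < γ) (M : ℝ) :
    ∃ h : ℝ, 0 < h ∧ M * h ^ γ ≤ 1 / 2 ∧ sewingConst (2 * γ) * (2 * (M * h ^ γ)) ≤ 1 := by
  have hc := sewingConst_pos (show 1 < 2 * γ by linarith)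
  obtain ⟨h, ⟨h1, h2⟩, h0⟩ := ((eventually_mul_rpow_le M (show 0 < γ by linarith)
    (one_half_pos (α := ℝ))).and (eventually_mul_rpow_le (sewingConst (2 * γ) * (2 * M))
      (show 0 < γ by linarith) one_pos)).and self_mem_nhdsWithin |>.exists
  exact ⟨h, h0, h1, by linarith⟩

lemma HasLocalExpansion.extend [ProperSpace E] (hY : LocalYoungBounds Y T γ κ)
    (hγ : 1 / 2 < γ) (hcont : ∀ t, Continuous (Y t)) {M h τ b : ℝ} {y : ℝ → E}
    (hM : YoungBounds Y T γ (Metric.closedBall (y τ) 1) M)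
    (hh1 : M * h ^ γ ≤ 1 / 2) (hh2 : sewingConst (2 * γ) * (2 * (M * h ^ γ)) ≤ 1)
    (hτ : 0 ≤ τ) (hτb : τ ≤ b) (hbh : b - τ ≤ h) (hbT : b ≤ T)
    (hy : HasLocalExpansion Y γ 0 τ y) : Reaches Y γ (y 0) b := by
  obtain ⟨z, hz0, hz⟩ := exists_hasLocalExpansion hγ hM hcont hh1 hh2 hτ hτb hbh hbT
  obtain ⟨R, hR⟩ := hY.exists_mem_closedBall (by linarith) (hτb.trans hbT) hy
  obtain ⟨M', hM', -⟩ := hY R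
  exact ⟨_, by simp [hτ], hy.glue (by linarith) hτ hτb hbT hM' hR hz hz0⟩

lemma isNLYoungSolution_of_hasLocalExpansion (hY : LocalYoungBounds Y T γ κ) (hγ : 1 / 2 < γ)
    {Ts : ℝ≥0∞} {y : ℝ → E}
    (hy : ∀ τ, 0 ≤ τ → τ ≤ T → ENNReal.ofReal τ < Ts → HasLocalExpansion Y γ 0 τ y) :
    IsNLYoungSolution T {γ} (fun u v z => Y v z - Y u z) (y 0) Ts y := by
  refine ⟨rfl, fun τ h0 hτ hTs γ' hγ' => ?_, fun t h0 ht hTs => ?_⟩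
  · obtain rfl : γ' = γ := hγ'
    have hexp := hy τ h0 hτ hTs
    obtain ⟨R, hR⟩ := hY.exists_mem_closedBall (by linarith) hτ hexp
    obtain ⟨M, hM, -⟩ := hY R
    obtain ⟨H, -, hH⟩ := hexp.exists_holder (by linarith) hτ hR hM
    refine ⟨H, fun u hu v hv => ?_⟩
    rcases le_total u v with huv | huv
    · rw [abs_of_nonneg (sub_nonneg.2 huv)]
      exact hH u v hu.1 huv hv.2
    · rw [abs_sub_comm, abs_of_nonneg (sub_nonneg.2 huv), norm_sub_rev]
      exact hH v u hv.1 huv hu.2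
  · exact (hy t h0 ht.le hTs).riemannConv hγ le_rfl

lemma IsNLYoungSolution.hasLocalExpansion (hY : LocalYoungBounds Y T γ κ) (hγ : 1 / 2 < γ)
    {Ts : ℝ≥0∞} {x : E} {z : ℝ → E}
    (hz : IsNLYoungSolution T {γ} (fun u v z => Y v z - Y u z) x Ts z)
    {τ : ℝ} (h0 : 0 ≤ τ) (hτ : τ < T) (hTs : ENNReal.ofReal τ < Ts) :
    HasLocalExpansion Y γ 0 τ z := by
  obtain ⟨hz0, hzH, hzR⟩ := hz
  obtain ⟨C, hC⟩ := hzH τ h0 hτ.le hTs γ rfl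
  have hH : ∀ s t, 0 ≤ s → s ≤ t → t ≤ τ → ‖z t - z s‖ ≤ |C| * (t - s) ^ γ := by
    intro s t hs hst ht
    have := hC s ⟨hs, hst.trans ht⟩ t ⟨hs.trans hst, ht⟩
    rw [abs_of_nonneg (sub_nonneg.2 hst)] at this
    exact this.trans (mul_le_mul_of_nonneg_right (le_abs_self C)
      (Real.rpow_nonneg (sub_nonneg.2 hst) _))
  have hB : ∀ t, 0 ≤ t → t ≤ τ → z t ∈ Metric.closedBall 0 (‖z 0‖ + |C| * τ ^ γ) := by
    intro t ht0 ht
    rw [mem_closedBall_zero_iff]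
    have h1 := hH 0 t le_rfl ht0 ht
    have h2 : |C| * (t - 0) ^ γ ≤ |C| * τ ^ γ := by
      rw [sub_zero]
      exact mul_le_mul_of_nonneg_left (Real.rpow_le_rpow ht0 ht (by linarith)) (abs_nonneg C)
    linarith [norm_sub_norm_le (z t) (z 0)]
  obtain ⟨M, hM, -⟩ := hY (‖z 0‖ + |C| * τ ^ γ)
  refine hasLocalExpansion_of_riemannConv hγ hτ.le hM hB (abs_nonneg C) hH fun t ht0 ht => ?_
  rw [hz0]
  exact hzR t ht0 (ht.trans_lt hτ) ((ENNReal.ofReal_le_ofReal ht).trans_lt hTs)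

lemma eq_of_holder_of_eq_of_lt (hγ : 0 < γ) (hT : 0 < T) {y z : ℝ → E} {C D : ℝ}
    (hC : ∀ u ∈ Icc (0 : ℝ) T, ∀ v ∈ Icc (0 : ℝ) T, ‖y v - y u‖ ≤ C * |v - u| ^ γ)
    (hD : ∀ u ∈ Icc (0 : ℝ) T, ∀ v ∈ Icc (0 : ℝ) T, ‖z v - z u‖ ≤ D * |v - u| ^ γ)
    (h : ∀ t, 0 ≤ t → t < T → z t = y t) : z T = y T := by
  have hlim : ∀ (w : ℝ → E) (A : ℝ),
      (∀ u ∈ Icc (0 : ℝ) T, ∀ v ∈ Icc (0 : ℝ) T, ‖w v - w u‖ ≤ A * |v - u| ^ γ) →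
      Tendsto w (nhdsWithin T (Ico 0 T)) (nhds (w T)) := by
    intro w A hA
    rw [tendsto_iff_norm_sub_tendsto_zero]
    have h1 : Tendsto (fun s : ℝ => A * |s - T| ^ γ) (nhdsWithin T (Ico 0 T)) (nhds 0) := by
      have hc : Continuous fun s : ℝ => A * |s - T| ^ γ :=
        continuous_const.mul ((continuous_id.sub continuous_const).abs.rpow_const
          fun _ => Or.inr hγ.le)
      have := (hc.tendsto T).mono_left (nhdsWithin_le_nhds (s := Ico 0 T))
      simpa [Real.zero_rpow hγ.ne'] using this
    refine squeeze_zero' (Eventually.of_forall fun _ => norm_nonneg _) ?_ h1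
    filter_upwards [self_mem_nhdsWithin] with s hs
    exact hA T ⟨hT.le, le_rfl⟩ s ⟨hs.1, hs.2.le⟩
  have : (nhdsWithin T (Ico 0 T)).NeBot := by
    rw [nhdsWithin_Ico_eq_nhdsLT hT]
    infer_instance
  refine tendsto_nhds_unique (hlim z D hD) ((hlim y C hC).congr' ?_)
  filter_upwards [self_mem_nhdsWithin] with s hs
  exact (h s hs.1 hs.2).symm

lemma IsNLYoungSolution.eq_of_hasLocalExpansion (hY : LocalYoungBounds Y T γ κ) (hT : 0 < T)
    (hγ : 1 / 2 < γ) (hκ : 0 < κ) (hγκ : 1 < γ * (1 + κ)) {Ts : ℝ≥0∞} {y z : ℝ → E}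
    (hy : ∀ τ, 0 ≤ τ → τ ≤ T → ENNReal.ofReal τ < Ts → HasLocalExpansion Y γ 0 τ y)
    (hz : IsNLYoungSolution T {γ} (fun u v z => Y v z - Y u z) (y 0) Ts z) :
    ∀ t, 0 ≤ t → t ≤ T → ENNReal.ofReal t < Ts → z t = y t := by
  have hlt : ∀ t, 0 ≤ t → t < T → ENNReal.ofReal t < Ts → z t = y t := fun t h0 ht hTs =>
    hY.unique hγ hκ hγκ ht.le (hz.hasLocalExpansion hY hγ h0 ht hTs) (hy t h0 ht.le hTs) hz.1
      t h0 le_rfl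
  intro t h0 ht hTs
  rcases ht.eq_or_lt with rfl | h
  · obtain ⟨C, hC⟩ := (isNLYoungSolution_of_hasLocalExpansion hY hγ hy).2.1 t h0 le_rfl hTs γ rfl
    obtain ⟨D, hD⟩ := hz.2.1 t h0 le_rfl hTs γ rfl
    exact eq_of_holder_of_eq_of_lt (by linarith) hT hC hD fun s hs0 hs =>
      hlt s hs0 hs ((ENNReal.ofReal_le_ofReal hs.le).trans_lt hTs)
  · exact hlt t h0 h hTs

/-- The maximal solution started at `x`. -/
lemma exists_maximal_solution [ProperSpace E] (hY : LocalYoungBounds Y T γ κ) (hT : 0 < T)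
    (hγ : 1 / 2 < γ) (hκ : 0 < κ) (hγκ : 1 < γ * (1 + κ)) (hcont : ∀ t, Continuous (Y t))
    (x : E) :
    ∃ (Ts : ℝ≥0∞) (y : ℝ → E), y 0 = x ∧ 0 < Ts ∧ (Ts ≤ ENNReal.ofReal T ∨ Ts = ⊤) ∧
      (∀ τ, 0 ≤ τ → τ ≤ T → ENNReal.ofReal τ < Ts → HasLocalExpansion Y γ 0 τ y) ∧
      (Ts ≠ ⊤ → Tendsto (fun t => ‖y t‖) (nhdsWithin Ts.toReal (Iio Ts.toReal)) atTop) ∧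
      (∀ τ, 0 ≤ τ → τ ≤ T → Reaches Y γ x τ → ENNReal.ofReal τ ≤ Ts) ∧
      ((∃ M, ∀ x', YoungBounds Y T γ (Metric.closedBall x' 1) M) → Ts = ⊤) := by
  by_cases hreach : Reaches Y γ x T
  · obtain ⟨y, hy0, hy⟩ := hreach
    exact ⟨⊤, y, hy0, ENNReal.coe_lt_top, Or.inr rfl, fun τ _ hτ _ => hy.mono hτ,
      fun h => absurd rfl h, fun _ _ _ _ => le_top, fun _ => rfl⟩
  set S : Set ℝ := {τ | 0 ≤ τ ∧ τ ≤ T ∧ Reaches Y γ x τ} with hS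
  have h0S : (0 : ℝ) ∈ S := by
    refine ⟨le_rfl, hT.le, fun _ => x, rfl, 0, fun s t hs hst ht => ?_⟩
    obtain rfl : s = 0 := le_antisymm (hst.trans ht) hs
    obtain rfl : t = 0 := le_antisymm ht hst
    simp
  have hbdd : BddAbove S := ⟨T, fun τ hτ => hτ.2.1⟩
  set σ := sSup S with hσ
  have hσT : σ ≤ T := csSup_le ⟨0, h0S⟩ fun τ hτ => hτ.2.1
  have hσ0 : 0 ≤ σ := le_csSup hbdd h0S
  have hσS : ¬ Reaches Y γ x σ := by
    rintro ⟨y, hy0, hy⟩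
    have hlt : σ < T := lt_of_le_of_ne hσT fun h => hreach ⟨y, hy0, h ▸ hy⟩
    obtain ⟨M, hM, -⟩ := hY (‖y σ‖ + 1)
    obtain ⟨h, hh0, hh1, hh2⟩ := exists_step hγ M
    have hb : σ < min (σ + h) T := lt_min (by linarith) hlt
    have hr := hy.extend hY hγ hcont (hM.mono (Metric.closedBall_subset_closedBall'
      (by simp [add_comm]))) hh1 hh2 hσ0 hb.le (by linarith [min_le_left (σ + h) T])
      (min_le_right _ _)
    rw [hy0] at hr
    exact hb.not_ge (le_csSup hbdd ⟨hσ0.trans hb.le, min_le_right _ _, hr⟩)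
  have hreaches : ∀ τ, 0 ≤ τ → τ < σ → Reaches Y γ x τ := by
    intro τ _ hτσ
    obtain ⟨τ', ⟨_, _, y, hy0, hy⟩, hlt⟩ := exists_lt_of_lt_csSup ⟨0, h0S⟩ hτσ
    exact ⟨y, hy0, hy.mono hlt.le⟩
  have hσpos : 0 < σ := lt_of_le_of_ne hσ0 fun h => hσS (h ▸ h0S.2.2)
  have hpath : ∀ τ, ∃ y : ℝ → E, 0 ≤ τ → τ < σ → y 0 = x ∧ HasLocalExpansion Y γ 0 τ y := by
    intro τ
    by_cases h : 0 ≤ τ ∧ τ < σ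
    · obtain ⟨y, hy⟩ := hreaches τ h.1 h.2
      exact ⟨y, fun _ _ => hy⟩
    · exact ⟨fun _ => x, fun h1 h2 => absurd ⟨h1, h2⟩ h⟩
  choose Z hZ using hpath
  have hagree : ∀ τ, 0 ≤ τ → τ < σ → ∀ t, 0 ≤ t → t ≤ τ → Z t t = Z τ t := by
    intro τ hτ0 hτσ t ht0 htτ
    obtain ⟨a1, a2⟩ := hZ τ hτ0 hτσ
    obtain ⟨b1, b2⟩ := hZ t ht0 (htτ.trans_lt hτσ)
    exact hY.unique hγ hκ hγκ (htτ.trans (hτσ.le.trans hσT)) b2 (a2.mono htτ)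
      (b1.trans a1.symm) t ht0 le_rfl
  have hlocal : ∀ τ, 0 ≤ τ → τ < σ → HasLocalExpansion Y γ 0 τ fun t => Z t t := by
    intro τ hτ0 hτσ
    obtain ⟨-, C, hC⟩ := hZ τ hτ0 hτσ
    refine ⟨C, fun s t hs hst ht => ?_⟩
    have e1 := hagree τ hτ0 hτσ s hs (hst.trans ht)
    have e2 := hagree τ hτ0 hτσ t (hs.trans hst) ht
    simp only [e1, e2]
    exact hC s t hs hst ht
  have hextend : ∀ M h τ, M * h ^ γ ≤ 1 / 2 → sewingConst (2 * γ) * (2 * (M * h ^ γ)) ≤ 1 →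
      0 ≤ τ → τ < σ → σ - τ ≤ h → ¬ YoungBounds Y T γ (Metric.closedBall (Z τ τ) 1) M := by
    intro M h τ hh1 hh2 hτ0 hτσ hτh hM
    have hr : Reaches Y γ (Z 0 0) σ := HasLocalExpansion.extend (y := fun t => Z t t)
      hY hγ hcont hM hh1 hh2 hτ0 hτσ.le hτh hσT (hlocal τ hτ0 hτσ)
    rw [(hZ 0 le_rfl hσpos).1] at hr
    exact hσS hr
  refine ⟨ENNReal.ofReal σ, fun t => Z t t, (hZ 0 le_rfl hσpos).1, ENNReal.ofReal_pos.2 hσpos,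
    Or.inl (ENNReal.ofReal_le_ofReal hσT), fun τ hτ0 _ hτσ => hlocal τ hτ0
      ((ENNReal.ofReal_lt_ofReal_iff hσpos).1 hτσ), fun _ => ?_,
    fun τ hτ0 hτT hr => ENNReal.ofReal_le_ofReal (le_csSup hbdd ⟨hτ0, hτT, hr⟩), ?_⟩
  · rw [ENNReal.toReal_ofReal hσ0, tendsto_atTop]
    intro R
    obtain ⟨M, hM, -⟩ := hY (R + 1)
    obtain ⟨h, hh0, hh1, hh2⟩ := exists_step hγ M
    filter_upwards [Ioo_mem_nhdsLT (max_lt (by linarith : σ - h < σ) hσpos)] with t ht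
    by_contra! hlt
    have ht0 : 0 ≤ t := ((le_max_right _ _).trans_lt ht.1).le
    have hth : σ - h < t := (le_max_left _ _).trans_lt ht.1
    refine hextend M h t hh1 hh2 ht0 ht.2 (by linarith)
      (hM.mono (Metric.closedBall_subset_closedBall' ?_))
    rw [dist_zero_right]
    linarith
  · rintro ⟨M, hM⟩
    obtain ⟨h, hh0, hh1, hh2⟩ := exists_step hγ M
    obtain ⟨τ, hτ, hτσ⟩ := exists_between (max_lt (by linarith : σ - h < σ) hσpos)
    have hth : σ - h < τ := (le_max_left _ _).trans_lt hτ
    exact absurd (hM _) (hextend M h τ hh1 hh2 ((le_max_right _ _).trans_lt hτ).le hτσ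
      (by linarith))

end Maximal

lemma exists_bound_of_locally_bounded {X : Type*} [NormedAddCommGroup X] {f : X → ℝ}
    (hf : ∀ x, ∃ r : ℝ, 0 < r ∧ ∃ M : ℝ, ∀ x', ‖x' - x‖ ≤ r → f x' ≤ M) {K : Set X}
    (hK : IsCompact K) : ∃ M : ℝ, ∀ x ∈ K, f x ≤ M := by
  refine hK.induction_on (p := fun s => ∃ M : ℝ, ∀ x ∈ s, f x ≤ M) ⟨0, by simp⟩
    (fun s t hst ⟨M, hM⟩ => ⟨M, fun x hx => hM x (hst hx)⟩)
    (fun s t ⟨M, hM⟩ ⟨N, hN⟩ => ⟨max M N, ?_⟩) fun x _ => ?_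
  · rintro x (hx | hx)
    · exact (hM x hx).trans (le_max_left _ _)
    · exact (hN x hx).trans (le_max_right _ _)
  · obtain ⟨r, hr, M, hM⟩ := hf x
    exact ⟨_, mem_nhdsWithin_of_mem_nhds (Metric.closedBall_mem_nhds x hr), M,
      fun x' hx' => hM x' (mem_closedBall_iff_norm.1 hx')⟩

lemma youngBounds_of_fderiv {E : Type*} [NormedAddCommGroup E] [NormedSpace ℝ E]
    {Y : ℝ → E → E} {T γ M : ℝ} {G : E → ℝ} {B : Set E} (hB : Convex ℝ B)
    (hdiff : ∀ t, Differentiable ℝ (Y t)) (hM0 : 0 ≤ M) (hGM : ∀ x ∈ B, G x ≤ M)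
    (hi : ∀ s t : ℝ, 0 ≤ s → s ≤ t → t ≤ T → ∀ x : E,
      ‖Y t x - Y s x‖ + ‖fderiv ℝ (fun x' => Y t x' - Y s x') x‖ ≤ G x * (t - s) ^ γ) :
    YoungBounds Y T γ B M := by
  have hle : ∀ s t : ℝ, 0 ≤ s → s ≤ t → t ≤ T → ∀ x ∈ B,
      ‖Y t x - Y s x‖ + ‖fderiv ℝ (fun x' => Y t x' - Y s x') x‖ ≤ M * (t - s) ^ γ :=
    fun s t h0 hst ht x hx => (hi s t h0 hst ht x).trans
      (mul_le_mul_of_nonneg_right (hGM x hx) (Real.rpow_nonneg (sub_nonneg.2 hst) _))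
  refine ⟨hM0, fun s t h0 hst ht z hz => ?_, fun s t h0 hst ht z hz z' hz' => ?_⟩
  · linarith [hle s t h0 hst ht z hz, norm_nonneg (fderiv ℝ (fun x' => Y t x' - Y s x') z)]
  · refine hB.norm_image_sub_le_of_norm_fderiv_le (𝕜 := ℝ) (f := fun x' => Y t x' - Y s x')
      (fun w _ => ((hdiff t).sub (hdiff s)) w) (fun w hw => ?_) hz' hz
    linarith [hle s t h0 hst ht w hw, norm_nonneg (Y t w - Y s w)]

lemma fourPointBound_of_fderiv {E : Type*} [NormedAddCommGroup E] [NormedSpace ℝ E]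
    {Y : ℝ → E → E} {T γ κ M : ℝ} {G : E → ℝ} {F : E → E → ℝ} {B : Set E} (hB : Convex ℝ B)
    (hdiff : ∀ t, Differentiable ℝ (Y t)) (hκ : 0 ≤ κ) (hM0 : 0 ≤ M) (hGM : ∀ x ∈ B, G x ≤ M)
    (hFM : ∀ x ∈ B, ∀ x' ∈ B, F x x' ≤ M)
    (hi : ∀ s t : ℝ, 0 ≤ s → s ≤ t → t ≤ T → ∀ x : E,
      ‖Y t x - Y s x‖ + ‖fderiv ℝ (fun x' => Y t x' - Y s x') x‖ ≤ G x * (t - s) ^ γ)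
    (hii : ∀ s t : ℝ, 0 ≤ s → s ≤ t → t ≤ T → ∀ x x' : E,
      ‖fderiv ℝ (fun z => Y t z - Y s z) x - fderiv ℝ (fun z => Y t z - Y s z) x'‖
        ≤ F x x' * (t - s) ^ γ * ‖x - x'‖ ^ κ) :
    FourPointBound Y T γ κ B M := by
  intro s t h0 hst ht a ha b hb a' ha' b' hb' ρ haa hbb
  have hp : 0 ≤ (t - s) ^ γ := Real.rpow_nonneg (sub_nonneg.2 hst) _
  refine (norm_sub_sub_sub_le_of_fderiv (f := fun z => Y t z - Y s z)
    (A := M * (t - s) ^ γ) (Q := M * (t - s) ^ γ) ((hdiff t).sub (hdiff s)) hB hκ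
    (mul_nonneg hM0 hp) (fun z hz => ?_) (fun z hz z' hz' => ?_) ha hb ha' hb' haa hbb).trans
    (le_of_eq (by ring))
  · have := mul_le_mul_of_nonneg_right (hGM z hz) hp
    linarith [hi s t h0 hst ht z, norm_nonneg (Y t z - Y s z)]
  · refine (hii s t h0 hst ht z z').trans ?_
    gcongr
    exact hFM z hz z' hz'

/-- **Existence and uniqueness for abstract nonlinear Young equations.**
Let `T > 0`, `γ ∈ (1/2,1)`, `δ > 1/γ`, and let `Y : [0,T] × ℝ^d → ℝ^d` be continuous in
time and `C¹` in space, with (i) `|Y_{s,t}(x)| + |∇Y_{s,t}(x)| ≤ G(x)|t−s|^γ` and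
(ii) `|∇Y_{s,t}(x) − ∇Y_{s,t}(y)| ≤ F(x,y)|t−s|^γ|x−y|^{δ−1}` for locally bounded `G, F`.
Then for every `x ∈ ℝ^d` there are a maximal time `T⋆(x) ∈ (0,T] ∪ {∞}` and a unique
`γ`-Hölder path `y` on `[0,T⋆(x)) ∩ [0,T]` solving `y_t = x + ∫_0^t Y_{dr}(y_r)` in the
nonlinear Young sense.  If `T⋆(x) < ∞` then `|y_t| → ∞` as `t ↑ T⋆(x)`; the map
`x ↦ T⋆(x)⁻¹` is locally bounded; and if `G` and `F` are bounded then `T⋆(x) = ∞` for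
every `x`. -/
theorem stmt_18 {d : ℕ} (T γ δ : ℝ) (hT : 0 < T) (hγ : γ ∈ Set.Ioo (1/2:ℝ) 1)
    (hδ : 1/γ < δ)
    (Y : ℝ → Euc d → Euc d)
    (htime : ∀ x : Euc d, ContinuousOn (fun t => Y t x) (Set.Icc 0 T))
    (hspace : ∀ t : ℝ, ContDiff ℝ 1 (Y t))
    (G : Euc d → ℝ) (F : Euc d → Euc d → ℝ)
    (hGloc : ∀ x : Euc d, ∃ r : ℝ, 0 < r ∧ ∃ M : ℝ, ∀ x', ‖x' - x‖ ≤ r → G x' ≤ M)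
    (hFloc : ∀ p : Euc d × Euc d, ∃ r : ℝ, 0 < r ∧ ∃ M : ℝ,
      ∀ q : Euc d × Euc d, ‖q - p‖ ≤ r → F q.1 q.2 ≤ M)
    (hi : ∀ s t : ℝ, 0 ≤ s → s ≤ t → t ≤ T → ∀ x : Euc d,
      ‖Y t x - Y s x‖ + ‖fderiv ℝ (fun x' => Y t x' - Y s x') x‖ ≤ G x * (t - s) ^ γ)
    (hii : ∀ s t : ℝ, 0 ≤ s → s ≤ t → t ≤ T → ∀ x x' : Euc d,
      ‖fderiv ℝ (fun z => Y t z - Y s z) x - fderiv ℝ (fun z => Y t z - Y s z) x'‖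
        ≤ F x x' * (t - s) ^ γ * ‖x - x'‖ ^ (δ - 1)) :
    ∃ (Tstar : Euc d → ℝ≥0∞) (y : Euc d → ℝ → Euc d),
      (∀ x, 0 < Tstar x ∧ (Tstar x ≤ ENNReal.ofReal T ∨ Tstar x = ⊤)) ∧
      (∀ x, IsNLYoungSolution T {γ} (fun u v z => Y v z - Y u z) x (Tstar x) (y x)) ∧
      (∀ x z, IsNLYoungSolution T {γ} (fun u v z' => Y v z' - Y u z') x (Tstar x) z →
        ∀ t : ℝ, 0 ≤ t → t ≤ T → ENNReal.ofReal t < Tstar x → z t = y x t) ∧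
      (∀ x, Tstar x ≠ ⊤ →
        Tendsto (fun t => ‖y x t‖) (nhdsWithin (Tstar x).toReal (Set.Iio (Tstar x).toReal)) atTop) ∧
      (∀ x : Euc d, ∃ r : ℝ, 0 < r ∧ ∃ ε : ℝ, 0 < ε ∧
        ∀ x' : Euc d, ‖x' - x‖ ≤ r → ENNReal.ofReal ε ≤ Tstar x') ∧
      ((∃ MG : ℝ, ∀ x, G x ≤ MG) → (∃ MF : ℝ, ∀ x x', F x x' ≤ MF) →
        ∀ x, Tstar x = ⊤) := by
  obtain ⟨hγ1, hγ2⟩ := hγ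
  have hγ0 : 0 < γ := by linarith
  have hγδ : 1 < γ * δ := by
    rw [div_lt_iff₀ hγ0] at hδ
    linarith
  have hκ : 0 < δ - 1 := by
    by_contra! hle
    nlinarith
  have hγκ : 1 < γ * (1 + (δ - 1)) := by simpa using hγδ
  have hdiff : ∀ t, Differentiable ℝ (Y t) := fun t => (hspace t).differentiable one_ne_zero
  have hcont : ∀ t, Continuous (Y t) := fun t => (hspace t).continuous
  have hY : LocalYoungBounds Y T γ (δ - 1) := by
    intro R
    have hK := isCompact_closedBall (0 : Euc d) R
    obtain ⟨M₁, hM₁⟩ := exists_bound_of_locally_bounded hGloc hK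
    obtain ⟨M₂, hM₂⟩ := exists_bound_of_locally_bounded (f := fun q => F q.1 q.2) hFloc
      (hK.prod hK)
    have hG : ∀ z ∈ Metric.closedBall (0 : Euc d) R, G z ≤ |M₁| + |M₂| := fun z hz => by
      linarith [hM₁ z hz, le_abs_self M₁, abs_nonneg M₂]
    have hF : ∀ z ∈ Metric.closedBall (0 : Euc d) R, ∀ z' ∈ Metric.closedBall (0 : Euc d) R,
        F z z' ≤ |M₁| + |M₂| := fun z hz z' hz' => by
      linarith [hM₂ (z, z') ⟨hz, hz'⟩, le_abs_self M₂, abs_nonneg M₁]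
    exact ⟨|M₁| + |M₂|,
      youngBounds_of_fderiv (convex_closedBall _ _) hdiff (by positivity) hG hi,
      fourPointBound_of_fderiv (convex_closedBall _ _) hdiff hκ.le (by positivity) hG hF hi hii⟩
  choose Tstar y hy0 hpos hle hexp hblow hreach htop using
    exists_maximal_solution hY hT hγ1 hκ hγκ hcont
  refine ⟨Tstar, y, fun x => ⟨hpos x, hle x⟩, fun x => ?_, fun x z hz => ?_, hblow,
    fun x => ?_, ?_⟩
  · have := isNLYoungSolution_of_hasLocalExpansion hY hγ1 (hexp x)
    rwa [hy0] at this
  · have hz' : IsNLYoungSolution T {γ} (fun u v z => Y v z - Y u z) (y x 0) (Tstar x) z := by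
      rwa [hy0]
    exact hz'.eq_of_hasLocalExpansion hY hT hγ1 hκ hγκ (hexp x)
  · obtain ⟨M, hM, -⟩ := hY (‖x‖ + 2)
    obtain ⟨h, hh0, hh1, hh2⟩ := exists_step hγ1 M
    have hε : 0 < min h T := lt_min hh0 hT
    refine ⟨1, one_pos, min h T, hε, fun x' hx' => hreach x' _ hε.le (min_le_right _ _) ?_⟩
    refine exists_hasLocalExpansion hγ1 (hM.mono (Metric.closedBall_subset_closedBall' ?_))
      hcont hh1 hh2 le_rfl hε.le (by simp) (min_le_right _ _)
    rw [dist_zero_right]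
    linarith [norm_sub_norm_le x' x]
  · rintro ⟨MG, hMG⟩ - x
    exact htop x ⟨|MG|, fun x' => youngBounds_of_fderiv (convex_closedBall _ _) hdiff
      (abs_nonneg _) (fun z _ => (hMG z).trans (le_abs_self _)) hi⟩
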